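/- There exists a constant c_2(C_3) > 0 such that #F_ℚ(C_3; X) = c_2(C_3) X^{1/2} + O(X^{1/4} (log X)^2) as X → ∞. -/

import Mathlib

/-!
STATEMENT 5: There exists a constant `c₂(C₃) > 0` such that
`#F_ℚ(C₃; X) = c₂(C₃) X^{1/2} + O(X^{1/4} (log X)²)` as `X → ∞`,
where `F_ℚ(G; X)` is the set of subfields of a fixed algebraic closure of `ℚ`
that are Galois over `ℚ` with Galois group isomorphic to `G` and absolute
discriminant at most `X`.
-/

open scoped Classical

/-- The absolute value of the discriminant of a finite intermediate field of
`AlgebraicClosure ℚ / ℚ` (junk value `0` if the field is not finite over `ℚ`). -/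
noncomputable def absDisc (L : IntermediateField ℚ (AlgebraicClosure ℚ)) : ℕ :=
  if h : FiniteDimensional ℚ L then
    letI := h
    letI : NumberField L := ⟨⟩
    (NumberField.discr L).natAbs
  else 0

/-- `#F_ℚ(G; X)`: the number of field extensions `L/ℚ` inside a fixed algebraic
closure of `ℚ` that are Galois over `ℚ` with `Gal(L/ℚ) ≅ G` and `|disc(L/ℚ)| ≤ X`. -/
noncomputable def galoisCount (G : Type) [Group G] (X : ℝ) : ℕ :=
  Nat.card {L : IntermediateField ℚ (AlgebraicClosure ℚ) //
    FiniteDimensional ℚ L ∧ IsGalois ℚ L ∧ Nonempty ((L ≃ₐ[ℚ] L) ≃* G) ∧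
      (absDisc L : ℝ) ≤ X}

/-- The ring `ℤ[ω]` of Eisenstein integers, with `ω ^ 2 = -1 - ω`. -/
abbrev EisensteinInt : Type := QuadraticAlgebra ℤ (-1) (-1)

namespace EisensteinInt

open QuadraticAlgebra

theorem norm_eq (z : EisensteinInt) : norm z = z.re ^ 2 - z.re * z.im + z.im ^ 2 := by
  rw [norm_def]; ring

theorem four_mul_norm (z : EisensteinInt) :
    4 * norm z = (2 * z.re - z.im) ^ 2 + 3 * z.im ^ 2 := by
  rw [norm_eq]; ring

theorem norm_nonneg (z : EisensteinInt) : 0 ≤ norm z := by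
  have := four_mul_norm z
  nlinarith [sq_nonneg (2 * z.re - z.im), sq_nonneg z.im]

theorem norm_eq_zero_iff {z : EisensteinInt} : norm z = 0 ↔ z = 0 := by
  refine ⟨fun h => ?_, fun h => by simp [h]⟩
  have h4 := four_mul_norm z
  rw [h] at h4
  have him : z.im = 0 := by
    have : z.im ^ 2 = 0 := by nlinarith [sq_nonneg (2 * z.re - z.im), sq_nonneg z.im]
    simpa using this
  have hre : z.re = 0 := by
    have : (2 * z.re - z.im) ^ 2 = 0 := by
      nlinarith [sq_nonneg (2 * z.re - z.im), sq_nonneg z.im]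
    have := pow_eq_zero_iff (two_ne_zero) |>.1 this
    omega
  ext <;> simp [him, hre]

theorem norm_pos {z : EisensteinInt} (hz : z ≠ 0) : 0 < norm z :=
  lt_of_le_of_ne (norm_nonneg z) fun h => hz (norm_eq_zero_iff.1 h.symm)

instance : IsDomain EisensteinInt := by
  have : NoZeroDivisors EisensteinInt := ⟨fun {x y} h => by
    have h' : norm x * norm y = 0 := by rw [← map_mul, h]; simp
    rcases mul_eq_zero.1 h' with h | h
    · exact .inl (norm_eq_zero_iff.1 h)
    · exact .inr (norm_eq_zero_iff.1 h)⟩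
  exact NoZeroDivisors.to_isDomain _

/-- Division with remainder in the Eisenstein integers. -/
theorem exists_norm_sub_mul_lt (x : EisensteinInt) {y : EisensteinInt} (hy : y ≠ 0) :
    ∃ q : EisensteinInt, norm (x - y * q) < norm y := by
  have hn := norm_pos hy
  set n := norm y with hn'
  set w := x * star y with hw
  obtain ⟨a, ha⟩ : ∃ a : ℤ, |2 * (w.re - n * a)| ≤ n := by
    refine ⟨(2 * w.re + n) / (2 * n), ?_⟩
    have h1 := Int.mul_ediv_add_emod (2 * w.re + n) (2 * n)
    have h2 := Int.emod_nonneg (2 * w.re + n) (show 2 * n ≠ 0 by omega)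
    have h3 := Int.emod_lt_of_pos (2 * w.re + n) (show 0 < 2 * n by omega)
    rw [abs_le]; constructor <;> linarith
  obtain ⟨b, hb⟩ : ∃ a : ℤ, |2 * (w.im - n * a)| ≤ n := by
    refine ⟨(2 * w.im + n) / (2 * n), ?_⟩
    have h1 := Int.mul_ediv_add_emod (2 * w.im + n) (2 * n)
    have h2 := Int.emod_nonneg (2 * w.im + n) (show 2 * n ≠ 0 by omega)
    have h3 := Int.emod_lt_of_pos (2 * w.im + n) (show 0 < 2 * n by omega)
    rw [abs_le]; constructor <;> linarith
  refine ⟨⟨a, b⟩, ?_⟩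
  have key : norm (x - y * ⟨a, b⟩) * n = norm (w - (n : EisensteinInt) * ⟨a, b⟩) := by
    have h1 : w - (n : EisensteinInt) * ⟨a, b⟩ = star y * (x - y * ⟨a, b⟩) := by
      have : (n : EisensteinInt) = y * star y := by
        rw [hn', ← algebraMap_norm_eq_mul_star]; rfl
      rw [this, hw]; ring
    rw [h1, map_mul, QuadraticAlgebra.norm_star, mul_comm]
  have hb2 : norm (w - (n : EisensteinInt) * ⟨a, b⟩) < n * n := by
    rw [norm_eq]
    simp only [re_sub, im_sub, re_mul, im_mul, re_intCast, im_intCast, Int.cast_id]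
    obtain ⟨h1, h2⟩ := abs_le.1 ha
    obtain ⟨h3, h4⟩ := abs_le.1 hb
    ring_nf at h1 h2 h3 h4 ⊢
    nlinarith
  rw [← key] at hb2
  exact lt_of_mul_lt_mul_right hb2 hn.le

instance : IsPrincipalIdealRing EisensteinInt := by
  let E : EuclideanDomain EisensteinInt :=
    { (inferInstance : CommRing EisensteinInt) with
      exists_pair_ne := ⟨0, 1, zero_ne_one⟩
      quotient := fun x y => if hy : y = 0 then 0 else
        Classical.choose (exists_norm_sub_mul_lt x hy)
      quotient_zero := fun x => by simp
      remainder := fun x y => x - y * (if hy : y = 0 then 0 else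
        Classical.choose (exists_norm_sub_mul_lt x hy))
      quotient_mul_add_remainder_eq := fun x y => by ring
      r := fun x y => norm x < norm y
      r_wellFounded := by
        refine WellFounded.mono (measure fun z : EisensteinInt => (norm z).toNat).wf ?_
        intro x y h
        have := norm_nonneg x
        show (norm x).toNat < (norm y).toNat
        omega
      remainder_lt := fun x y hy => by
        simp only [dif_neg hy]
        exact Classical.choose_spec (exists_norm_sub_mul_lt x hy)
      mul_left_not_lt := fun x y hy => by
        rw [map_mul, not_lt]
        have h1 := norm_pos hy
        have h2 := norm_nonneg x
        nlinarith }
  exact @EuclideanDomain.to_principal_ideal_domain _ E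

/-- An Eisenstein integer whose norm is squarefree and prime to `3`. -/
def Admissible (z : EisensteinInt) : Prop := Squarefree (norm z) ∧ ¬ 3 ∣ norm z

theorem isUnit_iff {z : EisensteinInt} : IsUnit z ↔ norm z = 1 := by
  rw [isUnit_iff_norm_isUnit, Int.isUnit_iff]
  have := norm_nonneg z
  omega

theorem Admissible.ne_zero {z : EisensteinInt} (hz : Admissible z) : z ≠ 0 := by
  rintro rfl
  exact hz.2 (by simp)

theorem norm_dvd_norm {x y : EisensteinInt} (h : x ∣ y) : norm x ∣ norm y :=
  map_dvd QuadraticAlgebra.norm h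

theorem not_even_norm {z : EisensteinInt} (hz : Squarefree (norm z)) : ¬ 2 ∣ norm z := by
  intro h
  have h4 : (2 : ℤ) * 2 ∣ norm z := by
    rw [norm_eq] at h ⊢
    have hre : (2 : ℤ) ∣ z.re := by
      by_contra hre
      rw [Int.two_dvd_ne_zero] at hre
      rcases Int.even_or_odd z.im with hi | hi
      · have : Odd (z.re ^ 2 - z.re * z.im + z.im ^ 2) := by
          have hr : Odd z.re := Int.odd_iff.2 hre
          exact ((hr.pow).sub_even (hi.mul_left _)).add_even (hi.pow_of_ne_zero two_ne_zero)
        exact (Int.not_even_iff_odd.2 this) (even_iff_two_dvd.2 h)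
      · have : Odd (z.re ^ 2 - z.re * z.im + z.im ^ 2) := by
          have hr : Odd z.re := Int.odd_iff.2 hre
          exact ((hr.pow).sub_odd (hr.mul hi)).add_odd hi.pow
        exact (Int.not_even_iff_odd.2 this) (even_iff_two_dvd.2 h)
    obtain ⟨a, ha⟩ := hre
    have him : (2 : ℤ) ∣ z.im := by
      have : (2 : ℤ) ∣ z.im ^ 2 := by
        have h2 : (2 : ℤ) ∣ z.re ^ 2 - z.re * z.im := by
          rw [ha]; exact ⟨2 * a ^ 2 - a * z.im, by ring⟩
        exact (dvd_add_right h2).1 h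
      exact Int.prime_two.dvd_of_dvd_pow this
    obtain ⟨b, hb⟩ := him
    rw [ha, hb]
    exact ⟨a ^ 2 - a * b + b ^ 2, by ring⟩
  have := hz 2 h4
  rw [Int.isUnit_iff] at this
  omega

/-- A prime dividing an admissible norm does not divide both the trace and the imaginary part. -/
theorem Admissible.not_dvd_im {z : EisensteinInt} (hz : Admissible z) {p : ℤ} (hp : Prime p)
    (hpz : p ∣ norm z) (h1 : p ∣ 2 * z.re - z.im) : ¬ p ∣ z.im := by
  intro h2
  have h4 := four_mul_norm z
  have hpp : p * p ∣ 4 * norm z := by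
    rw [h4]
    exact dvd_add (by rw [sq]; exact mul_dvd_mul h1 h1)
      (Dvd.dvd.mul_left (by rw [sq]; exact mul_dvd_mul h2 h2) 3)
  have hp2 : ¬ p ∣ 2 := by
    intro h
    apply not_even_norm hz.1
    have := (hp.associated_of_dvd Int.prime_two h)
    exact this.symm.dvd.trans hpz
  have hcop : IsCoprime (p * p) (4 : ℤ) := by
    have : IsCoprime p 2 := (hp.coprime_iff_not_dvd).2 hp2
    have h4 : (4 : ℤ) = 2 * 2 := by norm_num
    rw [h4]
    exact (this.mul_left this).mul_right (this.mul_left this)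
  exact hp.not_isUnit (hz.1 p (hcop.dvd_of_dvd_mul_left hpp))

theorem Admissible.isUnit_of_dvd_of_dvd_star {z d : EisensteinInt} (hz : Admissible z)
    (h1 : d ∣ z) (h2 : d ∣ star z) : IsUnit d := by
  rw [isUnit_iff]
  by_contra hne
  have hd0 : d ≠ 0 := fun h => hz.ne_zero (by rw [h] at h1; exact zero_dvd_iff.1 h1)
  have hpos := norm_pos hd0
  obtain ⟨p, hp, hpd⟩ := Int.exists_prime_and_dvd (n := norm d) (by omega)
  have hpz := hpd.trans (norm_dvd_norm h1)
  have ht : p ∣ (2 * z.re - z.im) ^ 2 := by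
    have h3 : d ∣ ((2 * z.re - z.im : ℤ) : EisensteinInt) := by
      have : ((2 * z.re - z.im : ℤ) : EisensteinInt) = z + star z := by
        ext
        · simp; ring
        · simp
      rw [this]; exact dvd_add h1 h2
    have := norm_dvd_norm h3
    rw [norm_intCast] at this
    exact hpd.trans (by simpa using this)
  have hb : p ∣ 3 * z.im ^ 2 := by
    have h3 : d ∣ z - star z := dvd_sub h1 h2
    have := norm_dvd_norm h3
    have h4 : norm (z - star z) = 3 * z.im ^ 2 := by
      rw [norm_eq]; simp; ring
    rw [h4] at this
    exact hpd.trans this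
  have ht' := hp.dvd_of_dvd_pow ht
  refine hz.not_dvd_im hp hpz ht' ?_
  rcases hp.dvd_or_dvd hb with h | h
  · exfalso
    apply hz.2
    exact ((hp.associated_of_dvd Int.prime_three h)).symm.dvd.trans hpz
  · exact hp.dvd_of_dvd_pow h

/-- `α ^ 2 * ᾱ` is cube-free for admissible `α`. -/
theorem Admissible.isUnit_of_cube_dvd {z d : EisensteinInt} (hz : Admissible z)
    (h : d ^ 3 ∣ z ^ 2 * star z) : IsUnit d := by
  by_contra hd
  have hd0 : d ≠ 0 := by
    rintro rfl
    rw [zero_pow three_ne_zero, zero_dvd_iff] at h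
    have h0 := hz.ne_zero
    have : star z ≠ 0 := by simpa using h0
    simp_all
  obtain ⟨π, hπ, hπd⟩ := WfDvdMonoid.exists_irreducible_factor hd hd0
  have hp : Prime π := hπ.prime
  have h3 : π ^ 3 ∣ z ^ 2 * star z := (pow_dvd_pow_of_dvd hπd 3).trans h
  have hns : ¬ π ∣ star z ∨ ¬ π ∣ z := by
    by_contra hcon
    push Not at hcon
    exact hπ.not_isUnit (hz.isUnit_of_dvd_of_dvd_star hcon.2 hcon.1)
  rcases hns with hns | hns
  · have h4 : π ^ 3 ∣ z ^ 2 := hp.pow_dvd_of_dvd_mul_right 3 hns h3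
    have h5 : π ∣ z := hp.dvd_of_dvd_pow ((dvd_pow_self π three_ne_zero).trans h4)
    obtain ⟨y, rfl⟩ := h5
    have h6 : π ∣ y ^ 2 := by
      have : π ^ 2 * π ∣ π ^ 2 * y ^ 2 := by
        rw [← pow_succ, ← mul_pow]; exact h4
      exact (mul_dvd_mul_iff_left (pow_ne_zero 2 hp.ne_zero)).1 this
    obtain ⟨x, rfl⟩ := hp.dvd_of_dvd_pow h6
    have := hz.1 (norm π) ⟨norm x, by rw [map_mul, map_mul]; ring⟩
    exact hπ.not_isUnit (isUnit_iff_norm_isUnit.2 this)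
  · have h4 : π ^ 3 ∣ star z := by
      refine hp.pow_dvd_of_dvd_mul_left 3 ?_ h3
      exact fun h => hns (hp.dvd_of_dvd_pow h)
    obtain ⟨y, hy⟩ := h4
    have hn : norm z = norm π ^ 3 * norm y := by
      rw [← QuadraticAlgebra.norm_star, hy, map_mul, map_pow]
    have := hz.1 (norm π) ⟨norm π * norm y, by rw [hn]; ring⟩
    exact hπ.not_isUnit (isUnit_iff_norm_isUnit.2 this)

theorem eq_of_norm_eq_one {z : EisensteinInt} (hz : norm z = 1) :
    z = 1 ∨ z = -1 ∨ z = ⟨0, 1⟩ ∨ z = ⟨0, -1⟩ ∨ z = ⟨1, 1⟩ ∨ z = ⟨-1, -1⟩ := by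
  obtain ⟨a, b⟩ := z
  have h4 := four_mul_norm ⟨a, b⟩
  rw [hz] at h4
  simp only at h4
  have hb : b ≤ 1 := by nlinarith [sq_nonneg (2 * a - b)]
  have hb' : -1 ≤ b := by nlinarith [sq_nonneg (2 * a - b)]
  have ha : a ≤ 1 := by nlinarith [sq_nonneg (2 * a - b)]
  have ha' : -1 ≤ a := by nlinarith [sq_nonneg (2 * a - b)]
  interval_cases b <;> interval_cases a <;> simp_all [QuadraticAlgebra.ext_iff]

theorem cube_of_isUnit {u : EisensteinInt} (hu : IsUnit u) : u ^ 3 = 1 ∨ u ^ 3 = -1 := by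
  rcases eq_of_norm_eq_one (isUnit_iff.1 hu) with rfl | rfl | rfl | rfl | rfl | rfl <;>
    simp [QuadraticAlgebra.ext_iff, pow_succ]

theorem mul_star_eq (z : EisensteinInt) : z * star z = (norm z : ℤ) := by
  rw [← algebraMap_norm_eq_mul_star]; rfl

theorem norm_sq_mul_star (z : EisensteinInt) : norm (z ^ 2 * star z) = norm z ^ 3 := by
  rw [map_mul, map_pow, QuadraticAlgebra.norm_star]; ring

theorem eq_or_eq_neg_of_sq_mul_star {z w : EisensteinInt} (hz : z ≠ 0)
    (h : w ^ 2 * star w = z ^ 2 * star z ∨ w ^ 2 * star w = -(z ^ 2 * star z)) :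
    w = z ∨ w = -z := by
  have hn : norm w = norm z := by
    have : norm w ^ 3 = norm z ^ 3 := by
      rw [← norm_sq_mul_star, ← norm_sq_mul_star]
      rcases h with h | h <;> rw [h]
      rw [QuadraticAlgebra.norm_neg]
    exact (Odd.strictMono_pow (by decide : Odd 3)).injective this
  have h1 (x : EisensteinInt) : x ^ 2 * star x = x * (norm x : ℤ) := by
    rw [← mul_star_eq]; ring
  have h0 : ((norm z : ℤ) : EisensteinInt) ≠ 0 := by
    exact_mod_cast (norm_pos hz).ne'
  rw [h1, h1, hn] at h
  rcases h with h | h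
  · exact .inl (mul_right_cancel₀ h0 h)
  · rw [← neg_mul] at h
    exact .inr (mul_right_cancel₀ h0 h)

/-- The class of `α ^ 2 * ᾱ` modulo cubes determines an admissible `α` up to sign. -/
theorem Admissible.eq_or_eq_neg {z w c d : EisensteinInt} (hz : Admissible z) (hw : Admissible w)
    (hc : c ≠ 0) (h : w ^ 2 * star w * c ^ 3 = z ^ 2 * star z * d ^ 3) :
    w = z ∨ w = -z := by
  obtain ⟨g, c', d', hcop, hc', hd'⟩ : ∃ g c' d' : EisensteinInt, IsCoprime c' d' ∧
      c = g * c' ∧ d = g * d' := by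
    obtain ⟨g, hg⟩ := (IsPrincipalIdealRing.principal (Ideal.span {c, d})).principal
    have hcg : c ∈ Ideal.span {g} := by
      have : c ∈ Ideal.span {c, d} := Ideal.subset_span (by simp)
      rw [hg] at this; exact this
    have hdg : d ∈ Ideal.span {g} := by
      have : d ∈ Ideal.span {c, d} := Ideal.subset_span (by simp)
      rw [hg] at this; exact this
    have hgg : g ∈ Ideal.span {c, d} := by
      rw [hg]; exact Ideal.subset_span (by simp)
    rw [Ideal.mem_span_singleton] at hcg hdg
    obtain ⟨c', hc'⟩ := hcg
    obtain ⟨d', hd'⟩ := hdg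
    obtain ⟨a, b, hab⟩ := Ideal.mem_span_pair.1 hgg
    refine ⟨g, c', d', ⟨a, b, ?_⟩, hc', hd'⟩
    have hg0 : g ≠ 0 := by rintro rfl; simp at hc'; exact hc hc'
    apply mul_left_cancel₀ hg0
    linear_combination hab - a * hc' - b * hd'
  have hg0 : g ≠ 0 := by rintro rfl; simp at hc'; exact hc hc'
  have h' : w ^ 2 * star w * c' ^ 3 = z ^ 2 * star z * d' ^ 3 := by
    apply mul_left_cancel₀ (pow_ne_zero 3 hg0)
    rw [hc', hd'] at h
    linear_combination h
  have hcu : IsUnit c' := by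
    apply hz.isUnit_of_cube_dvd
    have : c' ^ 3 ∣ z ^ 2 * star z * d' ^ 3 := ⟨w ^ 2 * star w, by rw [← h']; ring⟩
    exact (hcop.pow (m := 3) (n := 3)).dvd_of_dvd_mul_right this
  have hdu : IsUnit d' := by
    apply hw.isUnit_of_cube_dvd
    have : d' ^ 3 ∣ w ^ 2 * star w * c' ^ 3 := ⟨z ^ 2 * star z, by rw [h']; ring⟩
    exact (hcop.symm.pow (m := 3) (n := 3)).dvd_of_dvd_mul_right this
  apply eq_or_eq_neg_of_sq_mul_star hz.ne_zero
  rcases cube_of_isUnit hcu with h1 | h1 <;> rcases cube_of_isUnit hdu with h2 | h2 <;>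
    rw [h1, h2] at h'
  · left; simpa using h'
  · right; simpa using h'
  · right; rw [← neg_eq_iff_eq_neg]; simpa using h'
  · left; simpa using h'

theorem intCast_dvd_iff {n : ℤ} {z : EisensteinInt} :
    (n : EisensteinInt) ∣ z ↔ n ∣ z.re ∧ n ∣ z.im := algebraMap_dvd_iff

theorem star_dvd_star {x y : EisensteinInt} (h : x ∣ y) : star x ∣ star y := by
  obtain ⟨c, rfl⟩ := h
  exact ⟨star c, by rw [star_mul, mul_comm]⟩

theorem prime_of_prime_norm {z : EisensteinInt} (hz : Prime (norm z)) : Prime z := by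
  apply Irreducible.prime
  refine ⟨fun h => hz.not_isUnit (isUnit_iff_norm_isUnit.1 h), fun {a b} h => ?_⟩
  rw [h, map_mul] at hz
  rcases hz.irreducible.isUnit_or_isUnit rfl with h | h
  · exact .inl (isUnit_iff_norm_isUnit.2 h)
  · exact .inr (isUnit_iff_norm_isUnit.2 h)

/-- A rational prime either stays prime in `ℤ[ω]` or is a norm. -/
theorem prime_or_exists_norm_eq {p : ℕ} (hp : p.Prime) :
    Prime ((p : ℤ) : EisensteinInt) ∨ ∃ π : EisensteinInt, norm π = p := by
  have hp0 : ((p : ℤ) : EisensteinInt) ≠ 0 := by exact_mod_cast hp.ne_zero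
  have hnp : norm ((p : ℤ) : EisensteinInt) = (p : ℤ) ^ 2 := by rw [norm_intCast]; simp
  have hpu : ¬ IsUnit ((p : ℤ) : EisensteinInt) := by
    rw [isUnit_iff, hnp]
    have := hp.two_le
    intro h
    have : p ^ 2 = 1 := by exact_mod_cast h
    nlinarith
  obtain ⟨π, hπ, y, hy⟩ := WfDvdMonoid.exists_irreducible_factor hpu hp0
  have hn : norm π * norm y = (p : ℤ) ^ 2 := by rw [← map_mul, ← hy, hnp]
  have hdvd : (norm π).natAbs ∣ p ^ 2 := by
    have := Int.natAbs_dvd_natAbs.2 (Dvd.intro _ hn)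
    simpa [Int.natAbs_pow] using this
  have hππ : ((norm π).natAbs : ℤ) = norm π := Int.natAbs_of_nonneg (norm_nonneg π)
  obtain ⟨k, hk, hk'⟩ := (Nat.dvd_prime_pow hp).1 hdvd
  interval_cases k
  · exfalso
    apply hπ.not_isUnit
    rw [isUnit_iff, ← hππ, hk']; simp
  · right
    exact ⟨π, by rw [← hππ, hk']; simp⟩
  · left
    have hyu : IsUnit y := by
      rw [isUnit_iff]
      rw [← hππ, hk'] at hn
      have hne : ((p : ℤ) ^ 2) ≠ 0 := by exact_mod_cast pow_ne_zero 2 hp.ne_zero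
      apply mul_left_cancel₀ hne
      push_cast at hn
      rw [hn, mul_one]
    rw [hy]
    exact (associated_mul_unit_right π y hyu).prime hπ.prime

theorem dvd_of_prime_dvd_norm {p : ℕ} (hp : Prime ((p : ℤ) : EisensteinInt)) {z : EisensteinInt}
    (h : (p : ℤ) ∣ norm z) : ((p : ℤ) : EisensteinInt) ∣ z := by
  have h1 : ((p : ℤ) : EisensteinInt) ∣ z * star z := by
    rw [mul_star_eq]; exact_mod_cast (Int.castRingHom EisensteinInt).map_dvd h
  rcases hp.dvd_or_dvd h1 with h | h
  · exact h
  · have := star_dvd_star h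
    rwa [star_star, star_intCast] at this

theorem dvd_or_star_dvd {π z : EisensteinInt} (hp : Prime π)
    (h : norm π ∣ norm z) : π ∣ z ∨ star π ∣ z := by
  have h1 : π ∣ z * star z := by
    rw [mul_star_eq]
    refine Dvd.dvd.trans ?_ ((Int.castRingHom EisensteinInt).map_dvd h)
    exact ⟨star π, (mul_star_eq π).symm⟩
  rcases hp.dvd_or_dvd h1 with h | h
  · exact .inl h
  · right
    have := star_dvd_star h
    rwa [star_star] at this

/-- No cube of a non-unit divides `z`. -/
def CubeFree (z : EisensteinInt) : Prop := ∀ d : EisensteinInt, d ^ 3 ∣ z → IsUnit d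

theorem CubeFree.of_dvd {z w : EisensteinInt} (hz : CubeFree z) (h : w ∣ z) : CubeFree w :=
  fun d hd => hz d (hd.trans h)

theorem CubeFree.intCast_dvd {z : EisensteinInt} (hz : CubeFree z) {p : ℕ} (hp : p.Prime)
    (h : (p : ℤ) ^ 3 ∣ norm z) : ((p : ℤ) : EisensteinInt) ∣ z := by
  rcases prime_or_exists_norm_eq hp with hpp | ⟨π, hπ⟩
  · exact dvd_of_prime_dvd_norm hpp ((dvd_pow_self _ three_ne_zero).trans h)
  have hpz : Prime (p : ℤ) := Nat.prime_iff_prime_int.1 hp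
  have hπp : Prime π := prime_of_prime_norm (by rwa [hπ])
  have hsp : Prime (star π) := prime_of_prime_norm (by rwa [QuadraticAlgebra.norm_star, hπ])
  have hpe : ((p : ℤ) : EisensteinInt) = π * star π := by rw [mul_star_eq, hπ]
  have hp3 : (π * star π) ^ 3 ∣ z * star z := by
    rw [mul_star_eq z, ← hpe]
    have := (Int.castRingHom EisensteinInt).map_dvd h
    simpa using this
  have hstar : ∀ d : EisensteinInt, d ^ 3 ∣ star z → IsUnit d := fun d hd => by
    have h1 := star_dvd_star hd
    rw [star_star, star_pow] at h1
    have := hz _ h1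
    rwa [isUnit_iff, QuadraticAlgebra.norm_star, ← isUnit_iff] at this
  have h1 : π ∣ z := by
    by_contra hcon
    apply hπp.not_isUnit
    apply hstar
    apply hπp.pow_dvd_of_dvd_mul_left 3 hcon
    exact (pow_dvd_pow_of_dvd (dvd_mul_right _ _) 3).trans hp3
  have h2 : star π ∣ z := by
    by_contra hcon
    apply hsp.not_isUnit
    apply hstar
    apply hsp.pow_dvd_of_dvd_mul_left 3 hcon
    exact (pow_dvd_pow_of_dvd (dvd_mul_left _ _) 3).trans hp3
  obtain ⟨y, rfl⟩ := h1
  rw [hpe]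
  rcases hsp.dvd_or_dvd h2 with h3 | h3
  · have h4 : π ∣ y := by
      by_contra hcon
      have h5 : (π * star π) ^ 2 ∣ y * star y := by
        rw [star_mul] at hp3
        have h6 : (π * star π) * (π * star π) ^ 2 ∣ (π * star π) * (y * star y) := by
          convert hp3 using 1 <;> ring
        exact (mul_dvd_mul_iff_left (mul_ne_zero hπp.ne_zero hsp.ne_zero)).1 h6
      have h6 : π ^ 2 ∣ star y := by
        apply hπp.pow_dvd_of_dvd_mul_left 2 hcon
        exact (pow_dvd_pow_of_dvd (dvd_mul_right _ _) 2).trans h5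
      have h7 := star_dvd_star h6
      rw [star_star, star_pow] at h7
      have h8 : π ∣ star π := by
        have := star_dvd_star h3
        rwa [star_star] at this
      exact hcon (h8.trans ((dvd_pow_self _ two_ne_zero).trans h7))
    exact mul_dvd_mul_left π (h3.trans h4)
  · exact mul_dvd_mul_left π h3

theorem prime_lambda : Prime (⟨1, 2⟩ : EisensteinInt) := by
  apply prime_of_prime_norm
  rw [norm_eq]; norm_num

theorem CubeFree.exists_eq {z : EisensteinInt} (hz : CubeFree z) {q : ℤ} (hq : 0 < q)
    (h : norm z = q ^ 3) : ∃ w : EisensteinInt, Admissible w ∧ z = w ^ 2 * star w := by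
  have hdvd {p : ℕ} (hp : p.Prime) (hpq : (p : ℤ) ∣ q) : ((p : ℤ) : EisensteinInt) ∣ z :=
    hz.intCast_dvd hp (by rw [h]; exact pow_dvd_pow_of_dvd hpq 3)
  have hnp (n : ℤ) : norm (n : EisensteinInt) = n ^ 2 := by rw [norm_intCast]; simp
  have hsq : Squarefree q := by
    rw [← Int.squarefree_natAbs, Nat.squarefree_iff_prime_squarefree]
    intro p hp hpp
    have hpq : (p : ℤ) * p ∣ q := by
      have := Int.natCast_dvd.2 hpp
      push_cast at this; exact this
    have hp0 : (p : ℤ) ≠ 0 := by exact_mod_cast hp.ne_zero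
    obtain ⟨y, hy⟩ := hdvd hp ((dvd_mul_right _ _).trans hpq)
    obtain ⟨r, hr⟩ := hpq
    have hny : norm y = (p : ℤ) ^ 4 * r ^ 3 := by
      rw [hy, map_mul, hnp, hr] at h
      apply mul_left_cancel₀ (pow_ne_zero 2 hp0)
      rw [h]; ring
    obtain ⟨x, hx⟩ := (hz.of_dvd (Dvd.intro_left _ hy.symm)).intCast_dvd hp
      ⟨p * r ^ 3, by rw [hny]; ring⟩
    have hnx : norm x = (p : ℤ) ^ 2 * r ^ 3 := by
      rw [hx, map_mul, hnp] at hny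
      apply mul_left_cancel₀ (pow_ne_zero 2 hp0)
      rw [hny]; ring
    have hzx : z = (p : ℤ) * (p : ℤ) * x := by rw [hy, hx]; ring
    rcases prime_or_exists_norm_eq hp with hpp | ⟨π, hπ⟩
    · have := dvd_of_prime_dvd_norm hpp (z := x) ⟨p * r ^ 3, by rw [hnx]; ring⟩
      apply hpp.not_isUnit
      apply hz
      rw [hzx, pow_succ, sq]
      exact mul_dvd_mul_left _ this
    · have hpz : Prime (p : ℤ) := Nat.prime_iff_prime_int.1 hp
      have hπp : Prime π := prime_of_prime_norm (by rwa [hπ])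
      have hsp : Prime (star π) := prime_of_prime_norm (by rwa [QuadraticAlgebra.norm_star, hπ])
      have hpe : ((p : ℤ) : EisensteinInt) = π * star π := by rw [mul_star_eq, hπ]
      rcases dvd_or_star_dvd (z := x) hπp ⟨p * r ^ 3, by rw [hnx, hπ]; ring⟩ with h1 | h1
      · apply hπp.not_isUnit
        apply hz
        rw [hzx, pow_succ, sq, hpe]
        exact mul_dvd_mul (mul_dvd_mul (dvd_mul_right _ _) (dvd_mul_right _ _)) h1
      · apply hsp.not_isUnit
        apply hz
        rw [hzx, pow_succ, sq, hpe]
        exact mul_dvd_mul (mul_dvd_mul (dvd_mul_left _ _) (dvd_mul_left _ _)) h1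
  have h3q : ¬ 3 ∣ q := by
    intro h3
    obtain ⟨y, hy⟩ := hdvd Nat.prime_three (by exact_mod_cast h3)
    obtain ⟨r, hr⟩ := h3
    have hny : norm y = 3 * r ^ 3 := by
      rw [hy, map_mul, hnp, hr] at h
      push_cast at h
      linarith
    have hl : (⟨1, 2⟩ : EisensteinInt) ∣ y := by
      have hn : norm (⟨1, 2⟩ : EisensteinInt) = 3 := by rw [norm_eq]; norm_num
      rcases dvd_or_star_dvd (z := y) prime_lambda ⟨r ^ 3, by rw [hny, hn]⟩ with h1 | h1
      · exact h1
      · have : star (⟨1, 2⟩ : EisensteinInt) = -⟨1, 2⟩ := by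
          simp
        rwa [this, neg_dvd] at h1
    apply prime_lambda.not_isUnit
    apply hz
    rw [hy, pow_succ]
    refine mul_dvd_mul ⟨-1, ?_⟩ hl
    simp [sq]
    rfl
  have hqz : (q : EisensteinInt) ∣ z := by
    have aux (n : ℤ) (hn : ∀ p : ℕ, p.Prime → (p : ℤ) ∣ q → (p : ℤ) ∣ n) : q ∣ n := by
      rw [← Int.natAbs_dvd_natAbs]
      rw [← Nat.prod_primeFactors_of_squarefree (Int.squarefree_natAbs.2 hsq)]
      refine Finset.prod_primes_dvd _ (fun p hp => (Nat.prime_of_mem_primeFactors hp).prime)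
        fun p hp => ?_
      have := hn p (Nat.prime_of_mem_primeFactors hp)
        (Int.natCast_dvd.2 (Nat.dvd_of_mem_primeFactors hp))
      exact Int.natCast_dvd.1 this
    rw [intCast_dvd_iff]
    exact ⟨aux _ fun p hp hpq => (intCast_dvd_iff.1 (hdvd hp hpq)).1,
      aux _ fun p hp hpq => (intCast_dvd_iff.1 (hdvd hp hpq)).2⟩
  obtain ⟨w, hw⟩ := hqz
  have hnw : norm w = q := by
    rw [hw, map_mul, hnp] at h
    apply mul_left_cancel₀ (pow_ne_zero 2 hq.ne')
    rw [h]; ring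
  refine ⟨w, ⟨by rwa [hnw], by rwa [hnw]⟩, ?_⟩
  rw [hw, ← hnw, ← mul_star_eq]; ring

/-- An element whose norm is a cube is `α ^ 2 * ᾱ` up to cubes, with `α` admissible. -/
theorem exists_eq_cube_mul {z : EisensteinInt} (hz : z ≠ 0) {q : ℤ} (h : norm z = q ^ 3) :
    ∃ c w : EisensteinInt, c ≠ 0 ∧ Admissible w ∧ z = c ^ 3 * (w ^ 2 * star w) := by
  induction hn : (norm z).toNat using Nat.strong_induction_on generalizing z q with
  | _ n ih =>
    have hzpos := norm_pos hz
    have hq : 0 < q := by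
      by_contra hq
      have : q ^ 3 ≤ 0 := by
        have : (-q) ^ 3 ≥ 0 := pow_nonneg (by omega) 3
        nlinarith
      omega
    by_cases hc : CubeFree z
    · obtain ⟨w, hw, hzw⟩ := hc.exists_eq hq h
      exact ⟨1, w, one_ne_zero, hw, by rw [hzw]; ring⟩
    · unfold CubeFree at hc
      push Not at hc
      obtain ⟨d, ⟨y, hy⟩, hdu⟩ := hc
      have hy0 : y ≠ 0 := by rintro rfl; simp at hy; exact hz hy
      have hd0 : d ≠ 0 := by rintro rfl; simp at hy; exact hz hy
      have hnd := norm_pos hd0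
      have hny := norm_pos hy0
      have hnz : norm z = norm d ^ 3 * norm y := by rw [hy, map_mul, map_pow]
      obtain ⟨r, hr⟩ : norm d ∣ q := by
        rw [← Int.pow_dvd_pow_iff three_ne_zero, ← h, hnz]
        exact dvd_mul_right _ _
      have hyr : norm y = r ^ 3 := by
        apply mul_left_cancel₀ (pow_ne_zero 3 hnd.ne')
        rw [← hnz, h, hr]; ring
      have hlt : (norm y).toNat < n := by
        have h2 : 2 ≤ norm d := by
          rw [isUnit_iff] at hdu; omega
        have : 1 < norm d ^ 3 := one_lt_pow₀ (by omega) three_ne_zero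
        have : norm y < norm z := by rw [hnz]; nlinarith
        omega
      obtain ⟨c, w, hc, hw, hyc⟩ := ih _ hlt hy0 hyr rfl
      exact ⟨d * c, w, mul_ne_zero hd0 hc, hw, by rw [hy, hyc]; ring⟩

theorem finite_norm_eq (n : ℤ) : {z : EisensteinInt | norm z = n}.Finite := by
  have h : ((Finset.Icc (-(2 * |n|)) (2 * |n|) ×ˢ Finset.Icc (-(2 * |n|)) (2 * |n|)).image
    fun x : ℤ × ℤ => (⟨x.1, x.2⟩ : EisensteinInt) : Set EisensteinInt).Finite :=
      Finset.finite_toSet _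
  refine h.subset ?_
  rintro ⟨a, b⟩ hz
  have h4 := four_mul_norm ⟨a, b⟩
  rw [Set.mem_ofPred_eq] at hz
  rw [hz] at h4
  simp only at h4
  have hn : n ≤ |n| := le_abs_self n
  have h0 : 0 ≤ |n| := abs_nonneg n
  have hle (x : ℤ) (hx : x ^ 2 ≤ 4 * |n|) : -(2 * |n|) ≤ x ∧ x ≤ 2 * |n| := by
    rw [← abs_le]
    have hx2 : |x| ^ 2 ≤ 4 * |n| := by rwa [sq_abs]
    by_contra! hlt
    rcases h0.eq_or_lt with h1 | h1 <;> nlinarith [abs_nonneg x]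
  have hb := hle b (by nlinarith [sq_nonneg (2 * a - b)])
  have ha := hle a (by nlinarith [sq_nonneg (2 * b - a)])
  simp only [Finset.coe_image, Set.mem_image, Finset.mem_coe, Finset.mem_product, Finset.mem_Icc]
  exact ⟨(a, b), ⟨ha, hb⟩, rfl⟩

theorem exists_norm_eq_prime {p : ℕ} (hp : p.Prime) (h : p % 3 = 1) :
    ∃ π : EisensteinInt, norm π = p := by
  refine (prime_or_exists_norm_eq hp).resolve_left fun hpp => ?_
  have := Fact.mk hp
  obtain ⟨g, hg⟩ : ∃ g : (ZMod p)ˣ, orderOf g = 3 := by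
    have : Fact (Nat.Prime 3) := ⟨Nat.prime_three⟩
    apply exists_prime_orderOf_dvd_card
    rw [ZMod.card_units]
    omega
  have hg3 : ((g : ZMod p)) ^ 3 = 1 := by
    rw [← Units.val_pow_eq_pow_val, ← hg, pow_orderOf_eq_one]; rfl
  have hg1 : (g : ZMod p) ≠ 1 := by
    intro h1
    have : g = 1 := Units.ext h1
    rw [this, orderOf_one] at hg
    omega
  have hroot : (g : ZMod p) ^ 2 + g + 1 = 0 := by
    apply mul_left_cancel₀ (sub_ne_zero.2 hg1)
    linear_combination hg3
  obtain ⟨x, hx⟩ := ZMod.intCast_surjective (g : ZMod p)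
  have hdvd : (p : ℤ) ∣ norm (⟨x, -1⟩ : EisensteinInt) := by
    rw [norm_eq, ← ZMod.intCast_zmod_eq_zero_iff_dvd]
    push_cast
    rw [hx]
    linear_combination hroot
  have := (intCast_dvd_iff.1 (dvd_of_prime_dvd_norm hpp hdvd)).2
  have h1 : (p : ℤ) ∣ 1 := by simpa using this
  exact (Nat.prime_iff_prime_int.1 hp).not_isUnit (isUnit_of_dvd_one h1)

theorem norm_emod_three (z : EisensteinInt) : norm z % 3 ≠ 2 := by
  have h1 : norm z = (z.re + z.im) ^ 2 - 3 * (z.re * z.im) := by rw [norm_eq]; ring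
  have h2 : (z.re + z.im) ^ 2 % 3 ≠ 2 := by
    rw [sq, Int.mul_emod]
    have : (z.re + z.im) % 3 = 0 ∨ (z.re + z.im) % 3 = 1 ∨ (z.re + z.im) % 3 = 2 := by omega
    rcases this with h | h | h <;> rw [h] <;> norm_num
  omega

/-- The number of Eisenstein integers of a given norm. -/
noncomputable def normCount (n : ℤ) : ℕ := {z : EisensteinInt | norm z = n}.ncard

theorem normCount_one : normCount 1 = 6 := by
  have : {z : EisensteinInt | norm z = 1} =
      (({1, -1, ⟨0, 1⟩, ⟨0, -1⟩, ⟨1, 1⟩, ⟨-1, -1⟩} : Finset EisensteinInt) : Set EisensteinInt) := by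
    ext z
    simp only [Set.mem_ofPred_eq, Finset.coe_insert, Finset.coe_singleton, Set.mem_insert_iff,
      Set.mem_singleton_iff]
    refine ⟨eq_of_norm_eq_one, ?_⟩
    rintro (rfl | rfl | rfl | rfl | rfl | rfl) <;> rw [norm_eq] <;> simp
  rw [normCount, this, Set.ncard_coe_finset]
  simp [Finset.card_insert_of_notMem, QuadraticAlgebra.ext_iff]

theorem normCount_mul_of_mod_eq_two {p : ℕ} (hp : p.Prime) (h : p % 3 = 2) {n : ℕ}
    (hn : ¬ p ∣ n) : normCount ((p * n : ℕ) : ℤ) = 0 := by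
  rw [normCount, Set.ncard_eq_zero (finite_norm_eq _)]
  ext z
  simp only [Set.mem_ofPred_eq, Set.mem_empty_iff_false, iff_false]
  intro hz
  rcases prime_or_exists_norm_eq hp with hpp | ⟨π, hπ⟩
  · obtain ⟨y, hy⟩ := dvd_of_prime_dvd_norm hpp (z := z) ⟨n, by rw [hz]; push_cast; ring⟩
    apply hn
    rw [hy, map_mul, norm_intCast] at hz
    have hp0 : (p : ℤ) ≠ 0 := by exact_mod_cast hp.ne_zero
    have : (p : ℤ) * norm y = n := by
      apply mul_left_cancel₀ hp0
      push_cast at hz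
      rw [← hz]; ring
    exact Int.natCast_dvd_natCast.1 ⟨norm y, this.symm⟩
  · have := norm_emod_three π
    rw [hπ] at this
    omega

theorem normCount_mul_of_mod_eq_one {p : ℕ} (hp : p.Prime) (h : p % 3 = 1) {n : ℕ}
    (hn : ¬ p ∣ n) : normCount ((p * n : ℕ) : ℤ) = 2 * normCount n := by
  obtain ⟨π, hπ⟩ := exists_norm_eq_prime hp h
  have hpz : Prime (p : ℤ) := Nat.prime_iff_prime_int.1 hp
  have hπp : Prime π := prime_of_prime_norm (by rwa [hπ])
  have hadm : Admissible π := by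
    refine ⟨by rw [hπ]; exact hpz.squarefree, ?_⟩
    rw [hπ]; omega
  have hs0 : star π ≠ 0 := by simpa using hπp.ne_zero
  have hp0 : (p : ℤ) ≠ 0 := by exact_mod_cast hp.ne_zero
  have hset : {z : EisensteinInt | norm z = ((p * n : ℕ) : ℤ)} =
      (π * ·) '' {z | norm z = n} ∪ (star π * ·) '' {z | norm z = n} := by
    ext z
    simp only [Set.mem_ofPred_eq, Set.mem_union, Set.mem_image]
    constructor
    · intro hz
      rcases dvd_or_star_dvd (z := z) hπp (by rw [hz, hπ]; push_cast; exact dvd_mul_right _ _)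
        with ⟨y, hy⟩ | ⟨y, hy⟩
      · refine .inl ⟨y, ?_, hy.symm⟩
        rw [hy, map_mul, hπ] at hz
        push_cast at hz
        exact mul_left_cancel₀ hp0 hz
      · refine .inr ⟨y, ?_, hy.symm⟩
        rw [hy, map_mul, QuadraticAlgebra.norm_star, hπ] at hz
        push_cast at hz
        exact mul_left_cancel₀ hp0 hz
    · rintro (⟨y, hy, rfl⟩ | ⟨y, hy, rfl⟩)
      · rw [map_mul, hπ, hy]; push_cast; rfl
      · rw [map_mul, QuadraticAlgebra.norm_star, hπ, hy]; push_cast; rfl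
  have hdisj : Disjoint ((π * ·) '' {z : EisensteinInt | norm z = (n : ℤ)})
      ((star π * ·) '' {z | norm z = n}) := by
    rw [Set.disjoint_left]
    rintro _ ⟨x, hx, rfl⟩ ⟨y, hy, hxy⟩
    simp only [Set.mem_ofPred_eq] at hx hy hxy
    have hdvd : π ∣ star π * y := ⟨x, hxy⟩
    rcases hπp.dvd_or_dvd hdvd with h1 | h1
    · exact hπp.not_isUnit (hadm.isUnit_of_dvd_of_dvd_star dvd_rfl h1)
    · have := norm_dvd_norm h1
      rw [hy, hπ] at this
      exact hn (Int.natCast_dvd_natCast.1 this)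
  rw [normCount, hset, Set.ncard_union_eq hdisj ((finite_norm_eq _).image _)
    ((finite_norm_eq _).image _), Set.ncard_image_of_injective _ (mul_right_injective₀ hπp.ne_zero),
    Set.ncard_image_of_injective _ (mul_right_injective₀ hs0), normCount, two_mul]

/-- For squarefree `n` prime to `3`, the number of Eisenstein integers of norm `n`. -/
theorem normCount_eq {n : ℕ} (hn : Squarefree n) (h3 : ¬ 3 ∣ n) :
    normCount n = 6 * ∏ p ∈ n.primeFactors, if p % 3 = 1 then 2 else 0 := by
  induction n using induction_on_primes with
  | zero => simp at h3
  | one => simpa using normCount_one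
  | prime_mul p a hp ih =>
    have hcop : p.Coprime a := Nat.coprime_of_squarefree_mul hn
    have hpa : ¬ p ∣ a := (hp.coprime_iff_not_dvd).1 hcop
    have hih := ih (hn.of_mul_right) (fun h => h3 (h.mul_left p))
    rw [hcop.primeFactors_mul, Finset.prod_union hcop.disjoint_primeFactors,
      hp.primeFactors, Finset.prod_singleton]
    have hp3 : p % 3 ≠ 0 := fun h => h3 (Dvd.dvd.mul_right (Nat.dvd_of_mod_eq_zero h) a)
    by_cases h1 : p % 3 = 1
    · rw [normCount_mul_of_mod_eq_one hp h1 hpa, hih, if_pos h1]; ring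
    · rw [normCount_mul_of_mod_eq_two hp (by omega) hpa, if_neg h1]; simp

/-- One third of the Eisenstein integers of given norm prime to `3` are primary. -/
theorem three_mul_ncard_primary {n : ℤ} (hn : ¬ 3 ∣ n) :
    3 * {z : EisensteinInt | norm z = n ∧ 3 ∣ z.im}.ncard = normCount n := by
  set w : EisensteinInt := ⟨0, 1⟩ with hw
  have hw0 : w ≠ 0 := by simp [hw, QuadraticAlgebra.ext_iff]
  have hwn (z : EisensteinInt) : norm (w * z) = norm z := by
    rw [map_mul, hw, norm_eq]; simp
  have hinj := mul_right_injective₀ hw0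
  have him (z : EisensteinInt) : (w * z).im = z.re - z.im := by simp [hw]; ring
  have hre (z : EisensteinInt) : (w * z).re = - z.im := by simp [hw]
  have h3 (z : EisensteinInt) : w * (w * (w * z)) = z := by
    ext <;> simp [hw]
  set A := {z : EisensteinInt | norm z = n ∧ 3 ∣ z.im}
  set B := {z : EisensteinInt | norm z = n ∧ 3 ∣ z.re - z.im}
  set C := {z : EisensteinInt | norm z = n ∧ 3 ∣ z.re}
  have hAf : A.Finite := (finite_norm_eq n).subset fun z hz => hz.1
  have hBf : B.Finite := (finite_norm_eq n).subset fun z hz => hz.1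
  have hCf : C.Finite := (finite_norm_eq n).subset fun z hz => hz.1
  have hCA : C.ncard = A.ncard := by
    rw [← Set.ncard_image_of_injective A hinj]
    congr 1
    ext z
    constructor
    · rintro ⟨h1, h2⟩
      refine ⟨w * (w * z), ⟨by rw [hwn, hwn, h1], ?_⟩, h3 z⟩
      rw [him, hre, him]; omega
    · rintro ⟨y, ⟨h1, h2⟩, rfl⟩
      exact ⟨by rw [hwn, h1], by rw [hre]; omega⟩
  have hBA : B.ncard = A.ncard := by
    rw [← Set.ncard_image_of_injective B hinj]
    congr 1
    ext z
    constructor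
    · rintro ⟨y, ⟨h1, h2⟩, rfl⟩
      exact ⟨by rw [hwn, h1], by rw [him]; omega⟩
    · rintro ⟨h1, h2⟩
      refine ⟨w * (w * z), ⟨by rw [hwn, hwn, h1], ?_⟩, h3 z⟩
      rw [him, hre, him, hre]; omega
  have hunion : {z : EisensteinInt | norm z = n} = A ∪ (B ∪ C) := by
    ext z
    simp only [Set.mem_ofPred_eq, Set.mem_union, A, B, C]
    constructor
    · intro h
      have h3n : ¬ (3 : ℤ) ∣ z.re + z.im := by
        rintro ⟨k, hk⟩
        apply hn
        rw [← h, norm_eq]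
        exact ⟨3 * k ^ 2 - z.re * z.im, by linear_combination (z.re + z.im + 3 * k) * hk⟩
      have h1 : z.re % 3 = 0 ∨ z.re % 3 = 1 ∨ z.re % 3 = 2 := by omega
      have h2 : z.im % 3 = 0 ∨ z.im % 3 = 1 ∨ z.im % 3 = 2 := by omega
      have : (3 : ℤ) ∣ z.im ∨ (3 : ℤ) ∣ z.re - z.im ∨ (3 : ℤ) ∣ z.re := by
        rcases h1 with h1 | h1 | h1 <;> rcases h2 with h2 | h2 | h2 <;> omega
      tauto
    · tauto
  have hne (z : EisensteinInt) (h : norm z = n) : ¬ ((3 : ℤ) ∣ z.re ∧ (3 : ℤ) ∣ z.im) := by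
    rintro ⟨⟨a, ha⟩, ⟨b, hb⟩⟩
    apply hn
    rw [← h, norm_eq, ha, hb]
    exact ⟨3 * a ^ 2 - 3 * a * b + 3 * b ^ 2, by ring⟩
  have hd1 : Disjoint A (B ∪ C) := by
    rw [Set.disjoint_left]
    rintro z ⟨h1, h2⟩ (⟨_, h4⟩ | ⟨_, h4⟩) <;> apply hne z h1 <;> omega
  have hd2 : Disjoint B C := by
    rw [Set.disjoint_left]
    rintro z ⟨h1, h2⟩ ⟨_, h4⟩
    apply hne z h1; omega
  rw [normCount, hunion, Set.ncard_union_eq hd1 hAf (hBf.union hCf),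
    Set.ncard_union_eq hd2 hBf hCf, hCA, hBA]
  ring

end EisensteinInt

namespace EisensteinInt

open QuadraticAlgebra Polynomial

/-- The rational integer `z + star z`. -/
def tr (z : EisensteinInt) : ℤ := 2 * z.re - z.im

/-- `x` is a root of the cubic polynomial attached to `z`. -/
def IsCubicRoot {L : Type*} [Field L] (z : EisensteinInt) (x : L) : Prop :=
  x ^ 3 = 3 * ((norm z : ℤ) : L) * x + ((norm z : ℤ) : L) * ((tr z : ℤ) : L)

theorem four_mul_norm_eq_tr (z : EisensteinInt) : 4 * norm z = tr z ^ 2 + 3 * z.im ^ 2 :=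
  four_mul_norm z

/-- The cubic polynomial attached to an Eisenstein integer. -/
noncomputable def cubic (z : EisensteinInt) : ℤ[X] :=
  X ^ 3 - C (3 * norm z) * X - C (norm z * tr z)

theorem cubic_monic (z : EisensteinInt) : (cubic z).Monic := by
  unfold cubic; monicity!

theorem cubic_natDegree (z : EisensteinInt) : (cubic z).natDegree = 3 := by
  unfold cubic; compute_degree!

theorem aeval_cubic {L : Type*} [Field L] (z : EisensteinInt) (x : L) :
    aeval x (cubic z) = 0 ↔ IsCubicRoot z x := by
  unfold cubic IsCubicRoot
  rw [map_sub, map_sub, map_mul, map_pow, aeval_X, aeval_C, aeval_C, algebraMap_int_eq,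
    eq_intCast, eq_intCast]
  push_cast
  constructor <;> intro h
  · linear_combination h
  · linear_combination h

theorem Admissible.not_isCubicRoot_int {z : EisensteinInt} (hz : Admissible z) (him : z.im ≠ 0)
    (n : ℤ) : n ^ 3 ≠ 3 * norm z * n + norm z * tr z := by
  intro h
  by_cases hu : norm z = 1
  · have h4 := four_mul_norm_eq_tr z
    rw [hu] at h h4
    have hd : n ∣ tr z := ⟨n ^ 2 - 3, by linear_combination -h⟩
    have ht : tr z ≠ 0 := by
      intro h0; rw [h0] at h4; omega
    have ht1 : tr z ^ 2 ≤ 1 := by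
      have : 0 < z.im ^ 2 := by positivity
      omega
    have ht2 : -1 ≤ tr z ∧ tr z ≤ 1 := by constructor <;> nlinarith
    have hn : n ∣ 1 := by
      have : tr z = 1 ∨ tr z = -1 := by omega
      rcases this with h1 | h1
      · rwa [h1] at hd
      · rw [h1] at hd; exact (dvd_neg.1 hd)
    rcases Int.isUnit_iff.1 (isUnit_of_dvd_one hn) with h1 | h1 <;> rw [h1] at h <;> omega
  · obtain ⟨p, hp, hpz⟩ := Int.exists_prime_and_dvd (n := norm z) (by
      intro h1
      have := norm_nonneg z
      omega)
    have hpn : p ∣ n := hp.dvd_of_dvd_pow (n := 3) (by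
      rw [h]
      exact dvd_add ((hpz.mul_left 3).mul_right n) (hpz.mul_right _))
    obtain ⟨m, hm⟩ := hpz
    obtain ⟨k, hk⟩ := hpn
    have hpm : ¬ p ∣ m := by
      rintro ⟨l, hl⟩
      exact hp.not_isUnit (hz.1 p ⟨l, by rw [hm, hl]; ring⟩)
    have hpt : p ∣ tr z := by
      have : p ∣ m * tr z := by
        have h5 : p * (m * tr z) = p * (p * (p * k ^ 3 - 3 * m * k)) := by
          rw [hm, hk] at h
          linear_combination -h
        exact ⟨_, mul_left_cancel₀ hp.ne_zero h5⟩
      exact (hp.dvd_or_dvd this).resolve_left hpm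
    apply hz.not_dvd_im hp ⟨m, hm⟩ hpt
    have h3 : p ∣ 3 * z.im ^ 2 := by
      have := four_mul_norm_eq_tr z
      have h6 : 3 * z.im ^ 2 = 4 * norm z - tr z ^ 2 := by linarith
      rw [h6]
      exact dvd_sub (Dvd.dvd.mul_left ⟨m, hm⟩ 4) (dvd_pow hpt two_ne_zero)
    rcases hp.dvd_or_dvd h3 with h7 | h7
    · exfalso
      apply hz.2
      exact ((hp.associated_of_dvd Int.prime_three h7)).symm.dvd.trans ⟨m, hm⟩
    · exact hp.dvd_of_dvd_pow h7

theorem Admissible.irreducible_cubic {z : EisensteinInt} (hz : Admissible z) (him : z.im ≠ 0) :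
    Irreducible ((cubic z).map (algebraMap ℤ ℚ)) := by
  have hm : ((cubic z).map (algebraMap ℤ ℚ)).Monic := (cubic_monic z).map _
  have hd : ((cubic z).map (algebraMap ℤ ℚ)).natDegree = 3 := by
    rw [(cubic_monic z).natDegree_map, cubic_natDegree]
  rw [hm.irreducible_iff_roots_eq_zero_of_degree_le_three (by omega) (by omega),
    Multiset.eq_zero_iff_forall_notMem]
  intro q hq
  rw [mem_roots hm.ne_zero, IsRoot, eval_map_algebraMap] at hq
  obtain ⟨n, rfl⟩ := isInteger_of_is_root_of_monic (cubic_monic z) hq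
  rw [aeval_cubic, IsCubicRoot] at hq
  apply hz.not_isCubicRoot_int him n
  simp only [algebraMap_int_eq, eq_intCast] at hq
  exact_mod_cast hq

theorem Admissible.minpoly_eq {L : Type*} [Field L] [Algebra ℚ L] {z : EisensteinInt}
    (hz : Admissible z) (him : z.im ≠ 0) {x : L} (hx : IsCubicRoot z x) :
    minpoly ℚ x = (cubic z).map (algebraMap ℤ ℚ) := by
  refine (minpoly.eq_of_irreducible_of_monic (hz.irreducible_cubic him) ?_
    ((cubic_monic z).map _)).symm
  rw [aeval_map_algebraMap]
  exact (aeval_cubic z x).2 hx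

theorem IsCubicRoot.isIntegral {L : Type*} [Field L] {z : EisensteinInt} {x : L}
    (hx : IsCubicRoot z x) : IsIntegral ℤ x :=
  ⟨cubic z, cubic_monic z, (aeval_cubic z x).2 hx⟩

theorem IsCubicRoot.map {L M F : Type*} [Field L] [Field M] [FunLike F L M] [RingHomClass F L M]
    {z : EisensteinInt} {x : L} (hx : IsCubicRoot z x) (φ : F) : IsCubicRoot z (φ x) := by
  have := congrArg φ hx
  unfold IsCubicRoot
  simpa [map_ofNat] using this

/-- A cyclic cubic field generated by a root of the cubic polynomial attached to `z`. -/
structure Model (z : EisensteinInt) (L : Type*) [Field L] [NumberField L] where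
  /-- A root. -/
  x : L
  /-- The next conjugate root. -/
  y : L
  /-- A generator of the Galois group. -/
  σ : L ≃ₐ[ℚ] L
  xx : x * x = 2 * (norm z : ℤ) + ((z.re : L) - z.im) * x - z.im * y
  xy : x * y = -(norm z : ℤ) - z.re * x + ((z.im : L) - z.re) * y
  yy : y * y = 2 * (norm z : ℤ) + z.im * x + z.re * y
  σx : σ x = y
  σy : σ y = -x - y
  finrank_eq : Module.finrank ℚ L = 3

theorem norm_cast_eq {L : Type*} [Field L] (z : EisensteinInt) :
    ((norm z : ℤ) : L) = (z.re : L) ^ 2 - z.re * z.im + (z.im : L) ^ 2 := by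
  rw [norm_eq]; push_cast; ring

theorem tr_cast_eq {L : Type*} [Field L] (z : EisensteinInt) :
    ((tr z : ℤ) : L) = 2 * z.re - z.im := by
  rw [tr]; push_cast; ring

/-- A cubic field containing a root of the cubic attached to `z` is a model. -/
theorem Admissible.exists_model {L : Type*} [Field L] [NumberField L] {z : EisensteinInt}
    (hz : Admissible z) (him : z.im ≠ 0) {x : L} (hx : IsCubicRoot z x)
    (h3 : Module.finrank ℚ L = 3) : ∃ m : Model z L, m.x = x := by
  have hb : (z.im : L) ≠ 0 := by exact_mod_cast him
  have hint : IsIntegral ℚ x := Algebra.IsIntegral.isIntegral x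
  have hmin := hz.minpoly_eq him hx
  have hdeg : (minpoly ℚ x).natDegree = 3 := by
    rw [hmin, (cubic_monic z).natDegree_map, cubic_natDegree]
  have hx3 : x ^ 3 = 3 * ((norm z : ℤ) : L) * x + ((norm z : ℤ) : L) * ((tr z : ℤ) : L) := hx
  rw [tr_cast_eq] at hx3
  obtain ⟨y, hy⟩ : ∃ y : L, z.im * y = 2 * (norm z : ℤ) + ((z.re : L) - z.im) * x - x * x :=
    ⟨(2 * (norm z : ℤ) + ((z.re : L) - z.im) * x - x * x) / z.im, by field_simp⟩
  have hf := norm_cast_eq (L := L) z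
  set a : L := (z.re : L)
  set b : L := (z.im : L)
  set f : L := ((norm z : ℤ) : L)
  have hxx : x * x = 2 * f + (a - b) * x - b * y := by linear_combination hy
  have hxy : x * y = -f - a * x + (b - a) * y := by
    apply mul_left_cancel₀ hb
    linear_combination (x + a - b) * hy - hx3 - x * hf
  have hyy : y * y = 2 * f + b * x + a * y := by
    apply mul_left_cancel₀ hb
    linear_combination y * hy + (a - b - x) * hxy + a * hxx - (b - a) * hxy + (2 * y + x) * hf
  have hx1 : (minpoly ℚ x).natDegree = Module.finrank ℚ L := by rw [hdeg, h3]
  have hy3 : IsCubicRoot z y := by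
    rw [IsCubicRoot, tr_cast_eq]
    linear_combination (y + a) * hyy + b * hxy - y * hf
  have htop : IntermediateField.adjoin ℚ {x} = ⊤ :=
    Field.primitive_element_iff_minpoly_natDegree_eq ℚ x |>.2 hx1
  obtain ⟨σ, hσ⟩ : ∃ σ : L →ₐ[ℚ] L, σ x = y := by
    have hr : (Polynomial.aeval y) (minpoly ℚ x) = 0 := by
      rw [hmin, aeval_map_algebraMap]; exact (aeval_cubic z y).2 hy3
    have hadj : Algebra.adjoin ℚ {x} = ⊤ := by
      rw [← IntermediateField.adjoin_simple_toSubalgebra_of_isAlgebraic hint.isAlgebraic, htop,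
        IntermediateField.top_toSubalgebra]
    have hgen : (PowerBasis.ofAdjoinEqTop hint hadj).gen = x := PowerBasis.ofAdjoinEqTop_gen ..
    have hr' : (Polynomial.aeval y) (minpoly ℚ (PowerBasis.ofAdjoinEqTop hint hadj).gen) = 0 := by
      rw [hgen]; exact hr
    refine ⟨(PowerBasis.ofAdjoinEqTop hint hadj).lift y hr', ?_⟩
    exact PowerBasis.lift_gen (PowerBasis.ofAdjoinEqTop hint hadj) y hr'
  refine ⟨⟨x, y, AlgEquiv.ofBijective σ σ.bijective, hxx, hxy, hyy, hσ, ?_, h3⟩, rfl⟩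
  have h := congrArg σ hy
  simp only [a, b, f, map_mul, map_sub, map_add, map_intCast, map_ofNat, hσ] at h
  apply mul_left_cancel₀ hb
  change b * σ y = _
  simp only [a, b, f] at *
  linear_combination h - hyy

end EisensteinInt

namespace EisensteinInt

open QuadraticAlgebra

namespace Model

variable {z : EisensteinInt} {L : Type*} [Field L] [NumberField L] (m : Model z L)

theorem ratCast_eq_zero_of {p q r : ℚ} (hz : z ≠ 0)
    (h : (p : L) + q * m.x + r * m.y = 0) : p = 0 ∧ q = 0 ∧ r = 0 := by
  have h1 := congrArg m.σ h
  simp only [map_add, map_mul, map_ratCast, m.σx, m.σy, map_zero] at h1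
  have h2 := congrArg m.σ h1
  simp only [map_add, map_mul, map_ratCast, m.σx, m.σy, map_zero, map_sub, map_neg] at h2
  have hp : (p : L) = 0 := by
    have : (3 : L) * p = 0 := by linear_combination h + h1 + h2
    simpa using this
  have hx0 : m.x ≠ 0 := by
    intro hx
    have hy : m.y = 0 := by rw [← m.σx, hx, map_zero]
    have := m.xy
    rw [hx, hy] at this
    have h0 : ((norm z : ℤ) : L) = 0 := by linear_combination this
    exact hz (norm_eq_zero_iff.1 (by exact_mod_cast h0))
  have hd : ((q ^ 2 - q * r + r ^ 2 : ℚ) : L) * m.x = 0 := by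
    push_cast
    linear_combination (q - r) * h - r * h1 - (q - 2 * r) * hp
  have hd0 : q ^ 2 - q * r + r ^ 2 = 0 := by
    have := (mul_eq_zero.1 hd).resolve_right hx0
    exact_mod_cast this
  have hr : r = 0 := by nlinarith [sq_nonneg (2 * q - r), sq_nonneg r]
  refine ⟨by exact_mod_cast hp, ?_, hr⟩
  rw [hr] at hd0
  simpa using hd0

theorem linearIndependent (hz : z ≠ 0) : LinearIndependent ℚ ![1, m.x, m.y] := by
  rw [Fintype.linearIndependent_iff]
  intro g hg
  simp only [Fin.sum_univ_three, Matrix.cons_val_zero, Matrix.cons_val_one, Matrix.cons_val,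
    Algebra.smul_def, eq_ratCast, mul_one] at hg
  obtain ⟨h0, h1, h2⟩ := m.ratCast_eq_zero_of hz hg
  intro i
  fin_cases i <;> assumption

theorem exists_eq (hz : z ≠ 0) (u : L) : ∃ p q r : ℚ, u = p + q * m.x + r * m.y := by
  have hspan := (m.linearIndependent hz).span_eq_top_of_card_eq_finrank (by
    rw [m.finrank_eq]; rfl)
  have hu : u ∈ Submodule.span ℚ (Set.range ![1, m.x, m.y]) := by rw [hspan]; trivial
  rw [Submodule.mem_span_range_iff_exists_fun] at hu
  obtain ⟨c, rfl⟩ := hu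
  refine ⟨c 0, c 1, c 2, ?_⟩
  simp [Fin.sum_univ_three, Algebra.smul_def]

theorem σ_ne_one (hz : z ≠ 0) : m.σ ≠ 1 := by
  intro h
  have h1 := m.σx
  rw [h, AlgEquiv.one_apply] at h1
  have := m.ratCast_eq_zero_of (p := 0) (q := 1) (r := -1) hz (by push_cast; rw [← h1]; ring)
  norm_num at this

theorem σ_pow_three (hz : z ≠ 0) : m.σ ^ 3 = 1 := by
  ext u
  obtain ⟨p, q, r, rfl⟩ := m.exists_eq hz u
  simp only [pow_succ, pow_zero, one_mul, AlgEquiv.mul_apply, map_add, map_mul, map_ratCast,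
    m.σx, m.σy, map_sub, map_neg, AlgEquiv.one_apply]
  ring

theorem orderOf_σ (hz : z ≠ 0) : orderOf m.σ = 3 :=
  orderOf_eq_prime (m.σ_pow_three hz) (m.σ_ne_one hz)

theorem card_aut (m : Model z L) (hz : z ≠ 0) : Nat.card (L ≃ₐ[ℚ] L) = 3 := by
  apply le_antisymm
  · rw [← m.finrank_eq, Nat.card_eq_fintype_card]
    exact AlgEquiv.card_le
  · rw [← m.orderOf_σ hz]
    exact orderOf_le_card

theorem isGalois (m : Model z L) (hz : z ≠ 0) : IsGalois ℚ L :=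
  IsGalois.of_card_aut_eq_finrank ℚ L (by rw [m.card_aut hz, m.finrank_eq])

theorem nonempty_mulEquiv (m : Model z L) (hz : z ≠ 0) :
    Nonempty ((L ≃ₐ[ℚ] L) ≃* Multiplicative (ZMod 3)) := by
  have : Fact (Nat.Prime 3) := ⟨Nat.prime_three⟩
  exact ⟨mulEquivOfPrimeCardEq (p := 3) (m.card_aut hz) (by simp)⟩

theorem σ_sq_ne_one (hz : z ≠ 0) : m.σ ^ 2 ≠ 1 := by
  intro h
  have h3 := m.σ_pow_three hz
  rw [pow_succ, h, one_mul] at h3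
  exact m.σ_ne_one hz h3

theorem σ_ne_sq (hz : z ≠ 0) : m.σ ≠ m.σ ^ 2 := by
  intro h
  apply m.σ_ne_one hz
  have : m.σ * 1 = m.σ * m.σ := by rw [mul_one, ← sq]; exact h
  exact (mul_left_cancel this).symm

theorem univ_eq (hz : z ≠ 0) :
    (Finset.univ : Finset (L ≃ₐ[ℚ] L)) = {1, m.σ, m.σ ^ 2} := by
  symm
  apply Finset.eq_univ_of_card
  have h1 := m.σ_ne_one hz
  have h2 := m.σ_sq_ne_one hz
  have h12 := m.σ_ne_sq hz
  rw [← Nat.card_eq_fintype_card, m.card_aut hz, Finset.card_insert_of_notMem (by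
    simp [h1.symm, h2.symm]), Finset.card_insert_of_notMem (by simpa using h12),
    Finset.card_singleton]

theorem trace_eq (hz : z ≠ 0) (u : L) :
    ((Algebra.trace ℚ L u : ℚ) : L) = u + m.σ u + m.σ (m.σ u) := by
  have := m.isGalois hz
  have h := trace_eq_sum_automorphisms (K := ℚ) u
  have h12 := m.σ_ne_sq hz
  rw [m.univ_eq hz, Finset.sum_insert (by simp [(m.σ_ne_one hz).symm, (m.σ_sq_ne_one hz).symm]),
    Finset.sum_insert (by simpa using h12), Finset.sum_singleton] at h
  rw [← eq_ratCast (algebraMap ℚ L), h, sq, AlgEquiv.mul_apply, AlgEquiv.one_apply, add_assoc]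

end Model

theorem exists_int_of_isIntegral_ratCast {L : Type*} [Field L] [CharZero L] {q : ℚ}
    (h : IsIntegral ℤ (q : L)) : ∃ n : ℤ, (n : ℚ) = q := by
  have h1 : IsIntegral ℤ q := by
    rw [← eq_ratCast (algebraMap ℚ L), isIntegral_algebraMap_iff
      (algebraMap ℚ L).injective] at h
    exact h
  obtain ⟨n, hn⟩ := IsIntegrallyClosed.isIntegral_iff.1 h1
  exact ⟨n, by simpa using hn⟩

theorem exists_int_of_sq {q : ℚ} {n : ℤ} (h : q ^ 2 = n) : ∃ m : ℤ, (m : ℚ) = q := by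
  apply exists_int_of_isIntegral_ratCast (L := ℚ)
  refine IsIntegral.of_pow (n := 2) two_pos ?_
  rw [Rat.cast_id, h]
  exact isIntegral_intCast n

/-- An element of `ℚ(ω)` with integral trace and norm is an Eisenstein integer. -/
theorem exists_of_trace_norm {g h : ℚ} {s n : ℤ} (hs : 2 * g - h = s)
    (hn : g ^ 2 - g * h + h ^ 2 = n) : ∃ w : EisensteinInt, (w.re : ℚ) = g ∧ (w.im : ℚ) = h := by
  have h1 : (3 * h) ^ 2 = ((3 * (4 * n - s ^ 2) : ℤ) : ℚ) := by
    push_cast; rw [← hs, ← hn]; ring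
  obtain ⟨k, hk⟩ := exists_int_of_sq h1
  rw [← hk] at h1
  have h2 : k ^ 2 = 3 * (4 * n - s ^ 2) := by exact_mod_cast h1
  obtain ⟨l, rfl⟩ : (3 : ℤ) ∣ k := Int.prime_three.dvd_of_dvd_pow (n := 2) ⟨_, h2⟩
  have hl : (l : ℚ) = h := by push_cast at hk; linarith
  have h4 : 3 * l ^ 2 = 4 * n - s ^ 2 := by nlinarith
  have h5 : Even (s + l) := by
    have h6 : Even (3 * l ^ 2 + s ^ 2) := ⟨2 * n, by omega⟩
    simpa [Int.even_add, Int.even_mul, Int.even_pow, parity_simps, show ¬ Even (3 : ℤ) by decide,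
      iff_comm] using h6
  obtain ⟨j, hj⟩ := h5
  refine ⟨⟨j, l⟩, ?_, hl⟩
  have : ((s + l : ℤ) : ℚ) = ((j + j : ℤ) : ℚ) := by rw [hj]
  push_cast at this
  simp only
  linarith

theorem Admissible.dvd_of_cube_dvd {z : EisensteinInt} (hz : Admissible z) {w d : EisensteinInt}
    (hd : d ≠ 0) (h : d ^ 3 ∣ w ^ 3 * (z ^ 2 * star z)) : d ∣ w := by
  obtain ⟨d', w', c, hrel, rfl, rfl⟩ := UniqueFactorizationMonoid.exists_reduced_factors d hd w
  have hc : c ^ 3 ≠ 0 := pow_ne_zero _ (left_ne_zero_of_mul hd)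
  rw [mul_pow, mul_pow, mul_assoc, mul_dvd_mul_iff_left hc] at h
  have hcop : IsRelPrime (d' ^ 3) (w' ^ 3) := hrel.pow
  exact mul_dvd_mul_left c (hz.isUnit_of_cube_dvd (hcop.dvd_of_dvd_mul_left h)).dvd

/-- The trace of `(q + r ω) ^ 3 * z`. -/
def cubeTr {R : Type*} [CommRing R] (q r a b : R) : R :=
  (q ^ 3 - 3 * q * r ^ 2 + r ^ 3) * (2 * a - b) - (3 * q ^ 2 * r - 3 * q * r ^ 2) * (a + b)

theorem tr_cube_mul (v z : EisensteinInt) : tr (v ^ 3 * z) = cubeTr v.re v.im z.re z.im := by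
  simp [tr, cubeTr, pow_succ]; ring

theorem sq_mul_star (z : EisensteinInt) : z ^ 2 * star z = (norm z : ℤ) * z := by
  rw [← mul_star_eq]; ring

theorem tr_intCast_mul (n : ℤ) (z : EisensteinInt) : tr (n * z) = n * tr z := by
  simp [tr]; ring

namespace Model

variable {z : EisensteinInt} {L : Type*} [Field L] [NumberField L] (m : Model z L)

theorem mul_conj (p q r : ℚ) : ((p : L) + q * m.x + r * m.y) * (p + q * m.y + r * (-m.x - m.y)) =
    (p ^ 2 - (norm z : ℤ) * (q ^ 2 - q * r + r ^ 2)) +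
      (p * (q - r) - q * r * (z.re - z.im) - z.re * (q ^ 2 - q * r - r ^ 2)
        + (q * r - r ^ 2) * z.im) * m.x +
      (p * q + q * r * z.im + (z.im - z.re) * (q ^ 2 - q * r - r ^ 2)
        + (q * r - r ^ 2) * z.re) * m.y := by
  linear_combination (-q * r : L) * m.xx + (q ^ 2 - q * r - r ^ 2 : L) * m.xy +
    (q * r - r ^ 2 : L) * m.yy

theorem mul_conj_mul_conj (p q r : ℚ) : ((p : L) + q * m.x + r * m.y) *
    (p + q * m.y + r * (-m.x - m.y)) * (p + q * (-m.x - m.y) + r * m.x) =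
    p ^ 3 - 3 * p * (norm z : ℤ) * (q ^ 2 - q * r + r ^ 2) +
      (norm z : ℤ) * cubeTr (q : L) r z.re z.im := by
  rw [m.mul_conj]
  have hxx := m.xx
  have hxy := m.xy
  have hyy := m.yy
  rw [norm_cast_eq] at *
  rw [cubeTr]
  linear_combination (p * (q - r) - q * r * (z.re - z.im)
    - z.re * (q ^ 2 - q * r - r ^ 2) + (q * r - r ^ 2) * z.im : L) * (r - q) * hxx +
    (-q * (p * (q - r) - q * r * (z.re - z.im)
    - z.re * (q ^ 2 - q * r - r ^ 2) + (q * r - r ^ 2) * z.im : L) +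
    (p * q + q * r * z.im + (z.im - z.re) * (q ^ 2 - q * r - r ^ 2)
    + (q * r - r ^ 2) * z.re : L) * (r - q)) * hxy +
    (-q * (p * q + q * r * z.im + (z.im - z.re) * (q ^ 2 - q * r - r ^ 2)
    + (q * r - r ^ 2) * z.re : L)) * hyy

theorem exists_int_of_isIntegral (hz : Admissible z) {p q r : ℚ}
    (h : IsIntegral ℤ ((p : L) + q * m.x + r * m.y)) :
    ∃ (T e₂ e₃ : ℤ) (v : EisensteinInt), T = 3 * p ∧ v.re = 3 * q ∧ v.im = 3 * r ∧
      T ^ 2 - norm v * norm z = 3 * e₂ ∧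
      norm z * tr (v ^ 3 * z) = 2 * T ^ 3 - 9 * T * e₂ + 27 * e₃ := by
  have h1 : IsIntegral ℤ ((p : L) + q * m.y + r * (-m.x - m.y)) := by
    have := h.map (m.σ : L →ₐ[ℚ] L)
    simpa [m.σx, m.σy] using this
  have h2 : IsIntegral ℤ ((p : L) + q * (-m.x - m.y) + r * m.x) := by
    have := h1.map (m.σ : L →ₐ[ℚ] L)
    have h3 : (-m.y - (-m.x - m.y)) = m.x := by ring
    simpa [m.σx, m.σy, h3] using this
  obtain ⟨T, hT⟩ := exists_int_of_isIntegral_ratCast (q := 3 * p) (L := L) (by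
    have := (h.add h1).add h2
    rwa [show ((p : L) + q * m.x + r * m.y) + (p + q * m.y + r * (-m.x - m.y)) +
      (p + q * (-m.x - m.y) + r * m.x) = ((3 * p : ℚ) : L) by push_cast; ring] at this)
  obtain ⟨e₂, he₂⟩ := exists_int_of_isIntegral_ratCast (L := L)
    (q := 3 * p ^ 2 - 3 * (norm z : ℤ) * (q ^ 2 - q * r + r ^ 2)) (by
    have := ((h.mul h1).add (h1.mul h2)).add (h.mul h2)
    have hs : ((p : L) + q * m.x + r * m.y) * (p + q * m.y + r * (-m.x - m.y)) +
        (p + q * m.y + r * (-m.x - m.y)) * (p + q * (-m.x - m.y) + r * m.x) +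
        (p + q * m.x + r * m.y) * (p + q * (-m.x - m.y) + r * m.x) =
        ((3 * p ^ 2 - 3 * (norm z : ℤ) * (q ^ 2 - q * r + r ^ 2) : ℚ) : L) := by
      have hxx := m.xx
      have hxy := m.xy
      have hyy := m.yy
      push_cast
      linear_combination (-(q ^ 2 - q * r + r ^ 2) : L) * (hxx + hxy + hyy)
    rwa [hs] at this)
  obtain ⟨e₃, he₃⟩ := exists_int_of_isIntegral_ratCast (L := L)
    (q := p ^ 3 - 3 * p * (norm z : ℤ) * (q ^ 2 - q * r + r ^ 2) +
      (norm z : ℤ) * cubeTr q r z.re z.im) (by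
    have := (h.mul h1).mul h2
    rw [m.mul_conj_mul_conj] at this
    simpa [cubeTr] using this)
  have hf : ((norm z : ℤ) : ℚ) ≠ 0 := by
    have := norm_pos hz.ne_zero
    exact_mod_cast this.ne'
  have hfz := norm_cast_eq (L := ℚ) z
  have hN : ((norm z : ℤ) : ℚ) * (9 * (q ^ 2 - q * r + r ^ 2)) = ((T ^ 2 - 3 * e₂ : ℤ) : ℚ) := by
    push_cast
    rw [hT, he₂]; ring
  have hC : ((norm z : ℤ) : ℚ) * (27 * cubeTr q r z.re z.im) =
      ((2 * T ^ 3 - 9 * T * e₂ + 27 * e₃ : ℤ) : ℚ) := by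
    push_cast
    rw [hT, he₂, he₃]; ring
  obtain ⟨γ, hγ1, hγ2⟩ := exists_of_trace_norm
    (g := 27 * (norm z : ℤ) * ((q ^ 3 - 3 * q * r ^ 2 + r ^ 3) * z.re
      - (3 * q ^ 2 * r - 3 * q * r ^ 2) * z.im))
    (h := 27 * (norm z : ℤ) * ((q ^ 3 - 3 * q * r ^ 2 + r ^ 3) * z.im
      + (3 * q ^ 2 * r - 3 * q * r ^ 2) * (z.re - z.im)))
    (s := 2 * T ^ 3 - 9 * T * e₂ + 27 * e₃) (n := (T ^ 2 - 3 * e₂) ^ 3)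
    (by rw [← hC, cubeTr]; ring)
    (by rw [Int.cast_pow, ← hN, hfz]; ring)
  set D : ℤ := q.den * r.den with hD
  have hD0 : D ≠ 0 := by
    rw [hD]; exact_mod_cast mul_ne_zero q.den_ne_zero r.den_ne_zero
  have hq : q * D = ((q.num * r.den : ℤ) : ℚ) := by
    rw [hD]; push_cast
    rw [← mul_assoc, Rat.mul_den_eq_num]
  have hr : r * D = ((r.num * q.den : ℤ) : ℚ) := by
    rw [hD]; push_cast
    rw [mul_comm (q.den : ℚ), ← mul_assoc, Rat.mul_den_eq_num]
  set q' : ℤ := q.num * r.den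
  set r' : ℤ := r.num * q.den
  have hDQ : (D : ℚ) ≠ 0 := by exact_mod_cast hD0
  have hdvd : ((D : EisensteinInt)) ^ 3 ∣ (⟨3 * q', 3 * r'⟩ : EisensteinInt) ^ 3 *
      (z ^ 2 * star z) := by
    refine ⟨γ, ?_⟩
    rw [sq_mul_star]
    have e1 : ((D : EisensteinInt)) ^ 3 * γ = ⟨D ^ 3 * γ.re, D ^ 3 * γ.im⟩ := by
      have (n : ℤ) : (n : EisensteinInt) * γ = ⟨n * γ.re, n * γ.im⟩ := by ext <;> simp
      rw [← Int.cast_pow, this]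
    rw [e1]
    ext
    · simp only [pow_succ, pow_zero, one_mul, re_mul, im_mul, re_intCast, im_intCast]
      have : (γ.re : ℚ) * D ^ 3 = ((27 * norm z * ((q' ^ 3 - 3 * q' * r' ^ 2 + r' ^ 3) * z.re
          - (3 * q' ^ 2 * r' - 3 * q' * r' ^ 2) * z.im) : ℤ) : ℚ) := by
        push_cast
        rw [← hq, ← hr, hγ1]; ring
      have h5 : γ.re * D ^ 3 = 27 * norm z * ((q' ^ 3 - 3 * q' * r' ^ 2 + r' ^ 3) * z.re
          - (3 * q' ^ 2 * r' - 3 * q' * r' ^ 2) * z.im) := by exact_mod_cast this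
      linear_combination -h5
    · simp only [pow_succ, pow_zero, one_mul, re_mul, im_mul, re_intCast, im_intCast]
      have : (γ.im : ℚ) * D ^ 3 = ((27 * norm z * ((q' ^ 3 - 3 * q' * r' ^ 2 + r' ^ 3) * z.im
          + (3 * q' ^ 2 * r' - 3 * q' * r' ^ 2) * (z.re - z.im)) : ℤ) : ℚ) := by
        push_cast
        rw [← hq, ← hr, hγ2]; ring
      have h5 : γ.im * D ^ 3 = 27 * norm z * ((q' ^ 3 - 3 * q' * r' ^ 2 + r' ^ 3) * z.im
          + (3 * q' ^ 2 * r' - 3 * q' * r' ^ 2) * (z.re - z.im)) := by exact_mod_cast this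
      linear_combination -h5
  obtain ⟨v, hv⟩ := hz.dvd_of_cube_dvd (by exact_mod_cast hD0) hdvd
  have hv1 : 3 * q' = D * v.re := by simpa using congrArg QuadraticAlgebra.re hv
  have hv2 : 3 * r' = D * v.im := by simpa using congrArg QuadraticAlgebra.im hv
  have hv1' : (v.re : ℚ) = 3 * q := by
    apply mul_left_cancel₀ hDQ
    have : ((3 * q' : ℤ) : ℚ) = ((D * v.re : ℤ) : ℚ) := by rw [hv1]
    push_cast at this
    rw [← this, ← hq]; ring
  have hv2' : (v.im : ℚ) = 3 * r := by
    apply mul_left_cancel₀ hDQ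
    have : ((3 * r' : ℤ) : ℚ) = ((D * v.im : ℤ) : ℚ) := by rw [hv2]
    push_cast at this
    rw [← this, ← hr]; ring
  refine ⟨T, e₂, e₃, v, hT, hv1', hv2', ?_, ?_⟩
  · have : ((norm v * norm z : ℤ) : ℚ) = ((T ^ 2 - 3 * e₂ : ℤ) : ℚ) := by
      rw [← hN, Int.cast_mul, norm_cast_eq v, hv1', hv2']; ring
    have h6 : norm v * norm z = T ^ 2 - 3 * e₂ := by exact_mod_cast this
    rw [h6]; ring
  · have : ((norm z * tr (v ^ 3 * z) : ℤ) : ℚ) =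
        ((2 * T ^ 3 - 9 * T * e₂ + 27 * e₃ : ℤ) : ℚ) := by
      rw [← hC, tr_cube_mul, Int.cast_mul, cubeTr, cubeTr]
      push_cast
      rw [hv1', hv2']; ring
    exact_mod_cast this

end Model

theorem discr_eq_of_span {L : Type*} [Field L] [NumberField L] (w : Fin 3 → L)
    (hint : ∀ i, IsIntegral ℤ (w i)) (hli : LinearIndependent ℚ w)
    (hspan : ∀ u : L, IsIntegral ℤ u → ∃ n : Fin 3 → ℤ, u = n 0 * w 0 + n 1 * w 1 + n 2 * w 2) :
    (NumberField.discr L : ℚ) = (Algebra.traceMatrix ℚ w).det := by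
  let w' : Fin 3 → NumberField.RingOfIntegers L := fun i => ⟨w i, hint i⟩
  have hw' (i) : algebraMap (NumberField.RingOfIntegers L) L (w' i) = w i := rfl
  have hli' : LinearIndependent ℤ w' := by
    rw [Fintype.linearIndependent_iff]
    intro g hg i
    have h1 := congrArg (algebraMap (NumberField.RingOfIntegers L) L) hg
    rw [map_sum, map_zero] at h1
    have h2 := Fintype.linearIndependent_iff.1 hli (fun i => (g i : ℚ)) (by
      rw [← h1]
      apply Finset.sum_congr rfl
      intro j _
      rw [zsmul_eq_mul, map_mul, map_intCast, hw', Algebra.smul_def]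
      simp) i
    exact_mod_cast h2
  have hsp : ⊤ ≤ Submodule.span ℤ (Set.range w') := by
    rintro u -
    obtain ⟨n, hn⟩ := hspan (algebraMap (NumberField.RingOfIntegers L) L u) u.isIntegral_coe
    rw [Submodule.mem_span_range_iff_exists_fun]
    refine ⟨n, ?_⟩
    apply NumberField.RingOfIntegers.ext
    change algebraMap (NumberField.RingOfIntegers L) L _ =
      algebraMap (NumberField.RingOfIntegers L) L u
    rw [hn, Fin.sum_univ_three]
    simp only [zsmul_eq_mul, map_add, map_mul, map_intCast, hw']
  rw [← NumberField.discr_eq_discr L (Module.Basis.mk hli' hsp), Module.Basis.coe_mk,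
    Algebra.discr_def, ← eq_intCast (algebraMap ℤ ℚ), RingHom.map_det]
  congr 1
  ext i j
  simp only [RingHom.mapMatrix_apply, Matrix.map_apply, Algebra.traceMatrix_apply,
    Algebra.traceForm_apply]
  rw [eq_intCast, Algebra.coe_trace_int]
  exact congrArg _ (map_mul (algebraMap (NumberField.RingOfIntegers L) L) _ _)

theorem cubeTr_eq (v₁ v₂ a b : ℤ) : cubeTr v₁ v₂ a b =
    (v₁ + v₂) ^ 3 * (2 * a - b) - 9 * (v₁ * v₂ * (a * (v₁ + v₂) - b * v₂)) := by
  rw [cubeTr]; ring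

theorem Admissible.three_dvd_sub {z : EisensteinInt} (hz : Admissible z) {T e₂ e₃ : ℤ}
    {v : EisensteinInt} (h : norm z * tr (v ^ 3 * z) = 2 * T ^ 3 - 9 * T * e₂ + 27 * e₃) :
    3 ∣ T - (z.re + z.im) * (v.re + v.im) := by
  have h3 : ((norm z : ℤ) : ZMod 3) ≠ 0 := fun h0 =>
    hz.2 (by exact_mod_cast (ZMod.intCast_zmod_eq_zero_iff_dvd _ 3).1 h0)
  have h' := congrArg (Int.cast : ℤ → ZMod 3) h
  suffices ((T - (z.re + z.im) * (v.re + v.im) : ℤ) : ZMod 3) = 0 by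
    exact_mod_cast (ZMod.intCast_zmod_eq_zero_iff_dvd _ 3).1 this
  rw [tr_cube_mul, cubeTr_eq, norm_eq] at h'
  rw [norm_eq] at h3
  have h9 : (9 : ZMod 3) = 0 := by decide
  have h27 : (27 : ZMod 3) = 0 := by decide
  push_cast at *
  rw [h9, h27] at h'
  simp only [zero_mul, sub_zero, add_zero] at h'
  generalize (z.re : ZMod 3) = a at *
  generalize (z.im : ZMod 3) = b at *
  generalize (v.re : ZMod 3) = c at *
  generalize (v.im : ZMod 3) = d at *
  generalize (T : ZMod 3) = t at *
  revert a b c d t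
  decide

theorem Admissible.three_dvd_of_not_dvd_im {z : EisensteinInt} (hz : Admissible z)
    (him : ¬ 3 ∣ z.im) {T e₂ e₃ : ℤ} {v : EisensteinInt}
    (h : norm z * tr (v ^ 3 * z) = 2 * T ^ 3 - 9 * T * e₂ + 27 * e₃) :
    3 ∣ T ∧ 3 ∣ v.re ∧ 3 ∣ v.im := by
  obtain ⟨j, hj⟩ := hz.three_dvd_sub h
  have hf := hz.2
  have hS : ¬ 3 ∣ z.re + z.im := by
    rintro ⟨k, hk⟩
    apply hf
    rw [norm_eq]
    exact ⟨3 * k ^ 2 - z.re * z.im, by linear_combination (z.re + z.im + 3 * k) * hk⟩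
  rw [tr_cube_mul, cubeTr_eq] at h
  rw [norm_eq] at h hf
  obtain ⟨s, hs⟩ : ∃ s, s = v.re + v.im := ⟨_, rfl⟩
  rw [← hs] at h hj
  have hT : T = (z.re + z.im) * s + 3 * j := by linarith
  have hp := Int.prime_three
  have hs3 : 3 ∣ s := by
    have : 3 ∣ z.im ^ 2 * (z.re + z.im) * s ^ 3 := by
      refine ⟨-(z.re * z.im * (z.re + z.im) * s ^ 3 - z.re * z.im ^ 2 * s ^ 3 +
        (z.re ^ 2 - z.re * z.im + z.im ^ 2) * (v.re * v.im * (z.re * s - z.im * v.im)) +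
        2 * (z.re + z.im) ^ 2 * s ^ 2 * j + 6 * (z.re + z.im) * s * j ^ 2 + 6 * j ^ 3
        - ((z.re + z.im) * s + 3 * j) * e₂ + 3 * e₃), ?_⟩
      rw [hT] at h
      have h3 : (3 : ℤ) ≠ 0 := by norm_num
      apply mul_left_cancel₀ h3
      linear_combination -h
    rcases hp.dvd_or_dvd this with h1 | h1
    · rcases hp.dvd_or_dvd h1 with h2 | h2
      · exact absurd (hp.dvd_of_dvd_pow h2) him
      · exact absurd h2 hS
    · exact hp.dvd_of_dvd_pow h1
  obtain ⟨s', rfl⟩ := hs3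
  have hT3 : T = 3 * ((z.re + z.im) * s' + j) := by rw [hT]; ring
  refine ⟨⟨_, hT3⟩, ?_⟩
  have hv : 3 ∣ v.re * v.im ^ 2 := by
    have : 3 ∣ (z.re ^ 2 - z.re * z.im + z.im ^ 2) * z.im * (v.re * v.im ^ 2) := by
      rw [hT3] at h
      refine ⟨2 * ((z.re + z.im) * s' + j) ^ 3 - ((z.re + z.im) * s' + j) * e₂ + e₃ -
        (z.re ^ 2 - z.re * z.im + z.im ^ 2) * (s' ^ 3 * (2 * z.re - z.im)
         - v.re * v.im * z.re * s'), ?_⟩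
      have h9 : (9 : ℤ) ≠ 0 := by norm_num
      apply mul_left_cancel₀ h9
      linear_combination h
    rcases hp.dvd_or_dvd this with h1 | h1
    · rcases hp.dvd_or_dvd h1 with h2 | h2
      · exact absurd h2 hf
      · exact absurd h2 him
    · exact h1
  rcases hp.dvd_or_dvd hv with h1 | h1
  · constructor <;> omega
  · have := hp.dvd_of_dvd_pow h1
    constructor <;> omega

namespace Model

variable {z : EisensteinInt} {L : Type*} [Field L] [NumberField L] (m : Model z L)

theorem trace_mul (hz : z ≠ 0) (p q r p' q' r' : ℚ) :
    Algebra.trace ℚ L (((p : L) + q * m.x + r * m.y) * (p' + q' * m.x + r' * m.y)) =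
      3 * p * p' + (norm z : ℤ) * (6 * q * q' - 3 * (q * r' + q' * r) + 6 * r * r') := by
  have h := m.trace_eq hz (((p : L) + q * m.x + r * m.y) * (p' + q' * m.x + r' * m.y))
  have hinj : Function.Injective (Rat.cast : ℚ → L) := Rat.cast_injective
  apply hinj
  rw [h]
  have hxx := m.xx
  have hxy := m.xy
  have hyy := m.yy
  simp only [map_add, map_mul, map_ratCast, m.σx, m.σy, map_neg, map_sub]
  push_cast
  linear_combination (2 * (q * q' + r * r') - (q * r' + q' * r) : L) * (hxx + hxy + hyy)

theorem isIntegral_primary {k : ℤ} (hk : z.im = 3 * k) :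
    IsIntegral ℤ ((z.re + m.x) / 3) ∧ IsIntegral ℤ ((z.re + m.y) / 3) := by
  have h : IsIntegral ℤ ((z.re + m.x) / 3) := by
    refine ⟨Polynomial.X ^ 3 - Polynomial.C z.re * Polynomial.X ^ 2 +
      Polynomial.C (k * (z.re - 3 * k)) * Polynomial.X + Polynomial.C (k ^ 3), by monicity!, ?_⟩
    simp only [Polynomial.eval₂_add, Polynomial.eval₂_sub, Polynomial.eval₂_mul,
      Polynomial.eval₂_pow, Polynomial.eval₂_X, Polynomial.eval₂_C]
    simp only [eq_intCast]
    have hxx := m.xx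
    have hxy := m.xy
    rw [norm_cast_eq, hk] at hxx hxy
    push_cast at *
    linear_combination ((m.x + z.re - 3 * k) * hxx - 3 * k * hxy) / 27
  refine ⟨h, ?_⟩
  have := h.map (m.σ : L →ₐ[ℚ] L)
  simpa [m.σx, map_ofNat] using this

theorem discr_eq_of_dvd (m : Model z L) (hz : Admissible z) (h3 : 3 ∣ z.im) :
    NumberField.discr L = norm z ^ 2 := by
  obtain ⟨k, hk⟩ := h3
  have hz0 := hz.ne_zero
  obtain ⟨hi1, hi2⟩ := m.isIntegral_primary hk
  have hw1 : (z.re + m.x) / 3 = ((z.re / 3 : ℚ) : L) + ((1 / 3 : ℚ) : L) * m.x + (0 : ℚ) * m.y := by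
    push_cast; ring
  have hw2 : (z.re + m.y) / 3 = ((z.re / 3 : ℚ) : L) + (0 : ℚ) * m.x + ((1 / 3 : ℚ) : L) * m.y := by
    push_cast; ring
  have hw0 : (1 : L) = ((1 : ℚ) : L) + (0 : ℚ) * m.x + (0 : ℚ) * m.y := by
    push_cast; ring
  have h := discr_eq_of_span ![1, (z.re + m.x) / 3, (z.re + m.y) / 3] (by
    intro i
    fin_cases i
    · exact isIntegral_one
    · exact hi1
    · exact hi2) (by
    rw [Fintype.linearIndependent_iff]
    intro g hg
    simp only [Fin.sum_univ_three, Matrix.cons_val_zero, Matrix.cons_val_one, Matrix.cons_val,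
      Algebra.smul_def, eq_ratCast, mul_one] at hg
    obtain ⟨h0, h1, h2⟩ := m.ratCast_eq_zero_of (p := g 0 + (g 1 + g 2) * z.re / 3)
      (q := g 1 / 3) (r := g 2 / 3) hz0 (by push_cast; linear_combination hg)
    have h1 : g 1 = 0 := by linarith
    have h2 : g 2 = 0 := by linarith
    have h0 : g 0 = 0 := by rw [h1, h2] at h0; linarith
    intro i
    fin_cases i <;> assumption) (by
    intro u hu
    obtain ⟨p, q, r, rfl⟩ := m.exists_eq hz0 u
    obtain ⟨T, e₂, e₃, v, hT, hv1, hv2, -, he⟩ := m.exists_int_of_isIntegral hz hu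
    obtain ⟨j, hj⟩ := hz.three_dvd_sub he
    refine ⟨![j + k * (v.re + v.im), v.re, v.im], ?_⟩
    have hT' : T = 3 * j + (z.re + 3 * k) * (v.re + v.im) := by rw [hk] at hj; linarith
    obtain rfl : p = T / 3 := by rw [hT]; ring
    obtain rfl : q = v.re / 3 := by rw [hv1]; ring
    obtain rfl : r = v.im / 3 := by rw [hv2]; ring
    rw [hT']
    simp only [Matrix.cons_val_zero, Matrix.cons_val_one, Matrix.cons_val]
    push_cast
    ring)
  have h2 : (NumberField.discr L : ℚ) = ((norm z ^ 2 : ℤ) : ℚ) := by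
    rw [h, Matrix.det_fin_three]
    simp only [Algebra.traceMatrix_apply, Algebra.traceForm_apply, Matrix.cons_val_zero,
      Matrix.cons_val_one, Matrix.cons_val]
    rw [hw1, hw2, hw0]
    simp only [m.trace_mul hz0]
    push_cast
    ring
  exact_mod_cast h2

theorem discr_eq_of_not_dvd (hz : Admissible z) (h3 : ¬ 3 ∣ z.im) (hx : IsIntegral ℤ m.x) :
    NumberField.discr L = 81 * norm z ^ 2 := by
  have hz0 := hz.ne_zero
  have hy : IsIntegral ℤ m.y := by
    have := hx.map (m.σ : L →ₐ[ℚ] L)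
    simpa [m.σx, map_ofNat] using this
  have hw1 : m.x = ((0 : ℚ) : L) + ((1 : ℚ) : L) * m.x + (0 : ℚ) * m.y := by
    push_cast; ring
  have hw2 : m.y = ((0 : ℚ) : L) + (0 : ℚ) * m.x + ((1 : ℚ) : L) * m.y := by
    push_cast; ring
  have hw0 : (1 : L) = ((1 : ℚ) : L) + (0 : ℚ) * m.x + (0 : ℚ) * m.y := by
    push_cast; ring
  have h := discr_eq_of_span ![1, m.x, m.y] (by
    intro i
    fin_cases i
    · exact isIntegral_one
    · exact hx
    · exact hy) (m.linearIndependent hz0) (by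
    intro u hu
    obtain ⟨p, q, r, rfl⟩ := m.exists_eq hz0 u
    obtain ⟨T, e₂, e₃, v, hT, hv1, hv2, -, he⟩ := m.exists_int_of_isIntegral hz hu
    obtain ⟨⟨T', hT'⟩, ⟨a, ha⟩, ⟨b, hb⟩⟩ := hz.three_dvd_of_not_dvd_im h3 he
    refine ⟨![T', a, b], ?_⟩
    obtain rfl : p = T / 3 := by rw [hT]; ring
    obtain rfl : q = v.re / 3 := by rw [hv1]; ring
    obtain rfl : r = v.im / 3 := by rw [hv2]; ring
    rw [hT', ha, hb]
    simp only [Matrix.cons_val_zero, Matrix.cons_val_one, Matrix.cons_val]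
    push_cast
    ring)
  have h2 : (NumberField.discr L : ℚ) = ((81 * norm z ^ 2 : ℤ) : ℚ) := by
    rw [h, Matrix.det_fin_three]
    simp only [Algebra.traceMatrix_apply, Algebra.traceForm_apply, Matrix.cons_val_zero,
      Matrix.cons_val_one, Matrix.cons_val]
    have t11 := m.trace_mul hz0 0 1 0 0 1 0
    have t12 := m.trace_mul hz0 0 1 0 0 0 1
    have t21 := m.trace_mul hz0 0 0 1 0 1 0
    have t22 := m.trace_mul hz0 0 0 1 0 0 1
    have t01 := m.trace_mul hz0 1 0 0 0 1 0
    have t02 := m.trace_mul hz0 1 0 0 0 0 1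
    have t10 := m.trace_mul hz0 0 1 0 1 0 0
    have t20 := m.trace_mul hz0 0 0 1 1 0 0
    have t00 := m.trace_mul hz0 1 0 0 1 0 0
    rw [← hw1] at t11 t12 t21 t01 t10
    rw [← hw2] at t12 t21 t22 t02 t20
    rw [← hw0] at t00 t01 t02 t10 t20
    rw [t00, t01, t02, t10, t11, t12, t20, t21, t22]
    push_cast
    ring
  exact_mod_cast h2

end Model

/-- A cyclic cubic field contains a root of one of the cubics attached to admissible elements. -/
theorem exists_isCubicRoot {L : Type*} [Field L] [NumberField L] (σ : L ≃ₐ[ℚ] L)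
    (h3 : ∀ u, σ (σ (σ u)) = u) (hfix : ∀ u, σ u = u → ∃ r : ℚ, u = r)
    {t : L} (ht : IsIntegral ℤ t) (hσt : σ t ≠ t) :
    ∃ (z : EisensteinInt) (x : L), Admissible z ∧ z.im ≠ 0 ∧ IsCubicRoot z x ∧ σ x ≠ x := by
  have hint (u : L) (hu : IsIntegral ℤ u) (hs : σ u = u) : ∃ n : ℤ, u = n := by
    obtain ⟨r, rfl⟩ := hfix u hs
    obtain ⟨n, hn⟩ := exists_int_of_isIntegral_ratCast hu
    exact ⟨n, by rw [← hn, Rat.cast_intCast]⟩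
  obtain ⟨t₁, ht₁⟩ : ∃ t₁, t₁ = σ t := ⟨_, rfl⟩
  obtain ⟨t₂, ht₂⟩ : ∃ t₂, t₂ = σ t₁ := ⟨_, rfl⟩
  have ht₀ : σ t₂ = t := by rw [ht₂, ht₁, h3]
  have hi₁ : IsIntegral ℤ t₁ := by rw [ht₁]; exact ht.map (σ : L →ₐ[ℚ] L)
  have hi₂ : IsIntegral ℤ t₂ := by rw [ht₂]; exact hi₁.map (σ : L →ₐ[ℚ] L)
  obtain ⟨A, hA⟩ := hint (t ^ 3 + t₁ ^ 3 + t₂ ^ 3 + 6 • (t * t₁ * t₂))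
    ((((ht.pow 3).add (hi₁.pow 3)).add (hi₂.pow 3)).add (((ht.mul hi₁).mul hi₂).nsmul 6))
    (by simp only [map_add, map_mul, map_pow, map_nsmul, ← ht₁, ← ht₂, ht₀]; ring)
  obtain ⟨B, hB⟩ := hint (t ^ 2 * t₁ + t₁ ^ 2 * t₂ + t₂ ^ 2 * t)
    ((((ht.pow 2).mul hi₁).add ((hi₁.pow 2).mul hi₂)).add ((hi₂.pow 2).mul ht))
    (by simp only [map_add, map_mul, map_pow, ← ht₁, ← ht₂, ht₀]; ring)
  obtain ⟨C, hC⟩ := hint (t ^ 2 * t₂ + t₁ ^ 2 * t + t₂ ^ 2 * t₁)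
    ((((ht.pow 2).mul hi₂).add ((hi₁.pow 2).mul ht)).add ((hi₂.pow 2).mul hi₁))
    (by simp only [map_add, map_mul, map_pow, ← ht₁, ← ht₂, ht₀]; ring)
  obtain ⟨q, hq⟩ := hint (t ^ 2 + t₁ ^ 2 + t₂ ^ 2 - t * t₁ - t₁ * t₂ - t * t₂)
    ((((((ht.pow 2).add (hi₁.pow 2)).add (hi₂.pow 2)).sub (ht.mul hi₁)).sub (hi₁.mul hi₂)).sub
      (ht.mul hi₂))
    (by simp only [map_add, map_sub, map_mul, map_pow, ← ht₁, ← ht₂, ht₀]; ring)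
  have h6 : (6 : ℕ) • (t * t₁ * t₂) = 6 * (t * t₁ * t₂) := by simp
  rw [h6] at hA
  have hq0 : q ≠ 0 := by
    rintro rfl
    rw [Int.cast_zero] at hq
    have hu : t - t₁ ≠ 0 := fun h => hσt (by rw [← ht₁, sub_eq_zero.1 h])
    have hv : t₁ - t₂ ≠ 0 := fun h => by
      apply hu
      have := congrArg (fun u => σ (σ u)) h
      simpa only [map_sub, map_zero, ← ht₁, ← ht₂, ht₀] using this
    have hw : ((t₁ - t₂) / (t - t₁)) ^ 2 + (t₁ - t₂) / (t - t₁) + 1 = 0 := by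
      field_simp
      linear_combination hq
    obtain ⟨r, hr⟩ := hfix ((t₁ - t₂) / (t - t₁)) (by
      simp only [map_div₀, map_sub, ← ht₁, ← ht₂, ht₀]
      rw [div_eq_div_iff hv hu]
      linear_combination -hq)
    rw [hr] at hw
    have : r ^ 2 + r + 1 = 0 := by exact_mod_cast hw
    nlinarith [sq_nonneg (2 * r + 1)]
  obtain ⟨b, hb⟩ : ∃ b : EisensteinInt, b = ⟨A - 3 * C, 3 * (B - C)⟩ := ⟨_, rfl⟩
  have hnorm : norm b = q ^ 3 := by
    rw [norm_eq, hb]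
    have : (((A - 3 * C) ^ 2 - (A - 3 * C) * (3 * (B - C)) + (3 * (B - C)) ^ 2 : ℤ) : L) =
        ((q ^ 3 : ℤ) : L) := by
      push_cast
      rw [← hA, ← hB, ← hC, ← hq]
      ring
    exact_mod_cast this
  have hb0 : b ≠ 0 := by
    intro h0
    rw [norm_eq_zero_iff.2 h0] at hnorm
    exact hq0 (by simpa using hnorm.symm)
  obtain ⟨c, w, hc, hw, hbc⟩ := exists_eq_cube_mul hb0 hnorm
  have hNc : 0 < norm c := norm_pos hc
  have hqc : q = norm c * norm w := by
    have : norm c ^ 3 * norm w ^ 3 = q ^ 3 := by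
      rw [← hnorm, hbc, map_mul, map_pow, norm_sq_mul_star]
    rw [← mul_pow] at this
    exact ((Odd.strictMono_pow (by decide : Odd 3)).injective this).symm
  have htr : tr (star c ^ 3 * b) = norm c ^ 3 * (norm w * tr w) := by
    rw [hbc, ← mul_assoc, ← mul_pow, mul_comm (star c), mul_star_eq, sq_mul_star,
      ← Int.cast_pow, tr_intCast_mul, tr_intCast_mul]
  obtain ⟨Θ, hΘ⟩ : ∃ Θ : L, Θ = c.re * (2 * t - t₁ - t₂) + c.im * (2 * t₁ - t - t₂) := ⟨_, rfl⟩
  have hΘ3 : Θ ^ 3 = 3 * (norm c : ℤ) * q * Θ + (norm c : ℤ) ^ 3 * ((norm w : ℤ) * (tr w : ℤ)) := by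
    have h1 : ((tr (star c ^ 3 * b) : ℤ) : L) =
        (norm c : ℤ) ^ 3 * ((norm w : ℤ) * (tr w : ℤ)) := by
      rw [htr]; push_cast; rfl
    rw [← h1, tr_cube_mul, hb, hΘ, norm_eq, ← hq]
    simp only [cubeTr, re_star, im_star]
    push_cast
    rw [← hA, ← hB, ← hC]
    ring
  have hNcL : ((norm c : ℤ) : L) ≠ 0 := by exact_mod_cast hNc.ne'
  have htrw : tr w ≠ 0 := by
    intro h0
    have h4 := four_mul_norm_eq_tr w
    rw [h0] at h4
    apply hw.2
    omega
  have hσΘ : σ Θ ≠ Θ := by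
    intro h
    have h1 := congrArg σ h
    have hsum : Θ + σ Θ + σ (σ Θ) = 0 := by
      rw [hΘ]
      simp only [map_add, map_mul, map_sub, map_intCast, map_ofNat, ← ht₁, ← ht₂, ht₀]
      ring
    rw [h, h] at hsum
    have hΘ0 : Θ = 0 := by
      have : (3 : L) * Θ = 0 := by linear_combination hsum
      simpa using this
    rw [hΘ0] at hΘ3
    have : ((norm c ^ 3 * (norm w * tr w) : ℤ) : L) = 0 := by
      push_cast
      linear_combination -hΘ3
    have h0 : norm c ^ 3 * (norm w * tr w) = 0 := by exact_mod_cast this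
    rcases mul_eq_zero.1 h0 with h0 | h0
    · exact hNc.ne' (pow_eq_zero_iff (by norm_num) |>.1 h0)
    · rcases mul_eq_zero.1 h0 with h0 | h0
      · exact hw.ne_zero (norm_eq_zero_iff.1 h0)
      · exact htrw h0
  have hσx : σ (Θ / (norm c : ℤ)) ≠ Θ / (norm c : ℤ) := by
    rw [map_div₀, map_intCast]
    intro h
    exact hσΘ ((div_left_inj' hNcL).1 h)
  have hroot : IsCubicRoot w (Θ / (norm c : ℤ)) := by
    rw [IsCubicRoot]
    have hq' : (q : L) = (norm c : ℤ) * (norm w : ℤ) := by rw [hqc]; push_cast; rfl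
    rw [hq'] at hΘ3
    field_simp
    linear_combination hΘ3
  refine ⟨w, Θ / (norm c : ℤ), hw, ?_, hroot, hσx⟩
  intro him
  have hsq := hw.1
  rw [norm_eq, him] at hsq
  have hre : IsUnit w.re := by
    apply hsq
    exact ⟨1, by ring⟩
  generalize Θ / (norm c : ℤ) = x at hroot hσx
  rw [IsCubicRoot, norm_eq, tr, him] at hroot
  have hx : ∃ n : ℤ, x = n := by
    rcases Int.isUnit_iff.1 hre with h | h
    · rw [h] at hroot
      have : (x - 2) * (x + 1) ^ 2 = 0 := by
        push_cast at hroot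
        linear_combination hroot
      rcases mul_eq_zero.1 this with h | h
      · exact ⟨2, by push_cast; linear_combination h⟩
      · exact ⟨-1, by push_cast; linear_combination pow_eq_zero_iff (by norm_num) |>.1 h⟩
    · rw [h] at hroot
      have : (x + 2) * (x - 1) ^ 2 = 0 := by
        push_cast at hroot
        linear_combination hroot
      rcases mul_eq_zero.1 this with h | h
      · exact ⟨-2, by push_cast; linear_combination h⟩
      · exact ⟨1, by push_cast; linear_combination pow_eq_zero_iff (by norm_num) |>.1 h⟩
  obtain ⟨n, rfl⟩ := hx
  exact hσx (map_intCast σ n)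

theorem eq_or_eq_star {a b : EisensteinInt} (ht : tr a = tr b) (hn : norm a = norm b) :
    a = b ∨ a = star b := by
  have h1 := four_mul_norm_eq_tr a
  rw [hn, ht, four_mul_norm_eq_tr b] at h1
  have h2 : b.im ^ 2 = a.im ^ 2 := by linarith
  rw [tr, tr] at ht
  rcases sq_eq_sq_iff_eq_or_eq_neg.1 h2 with h | h
  · left; ext <;> omega
  · right
    ext
    · rw [re_star]; linarith
    · rw [im_star]; omega

theorem tr_star (z : EisensteinInt) : tr (star z) = tr z := by
  simp [tr, re_star, im_star]; ring

theorem norm_star' (z : EisensteinInt) : norm (star z) = norm z := by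
  simp

theorem norm_neg' (z : EisensteinInt) : norm (-z) = norm z := by
  simp [norm_eq]

theorem Admissible.star {z : EisensteinInt} (hz : Admissible z) : Admissible (star z) := by
  unfold Admissible
  rw [norm_star']
  exact hz

theorem Admissible.neg {z : EisensteinInt} (hz : Admissible z) : Admissible (-z) := by
  unfold Admissible
  rw [norm_neg']
  exact hz

theorem isCubicRoot_star {L : Type*} [Field L] {z : EisensteinInt} {x : L} :
    IsCubicRoot (Star.star z) x ↔ IsCubicRoot z x := by
  rw [IsCubicRoot, IsCubicRoot, tr_star, norm_star']

theorem isCubicRoot_neg {L : Type*} [Field L] {z : EisensteinInt} {x : L} :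
    IsCubicRoot (-z) x ↔ IsCubicRoot z (-x) := by
  have : tr (-z) = -tr z := by simp [tr]; ring
  rw [IsCubicRoot, IsCubicRoot, norm_neg', this]
  push_cast
  constructor <;> intro h <;> linear_combination -h

/-- The elements that give rise to the same cubic field as `z`. -/
def associates (z : EisensteinInt) : Finset EisensteinInt := {z, -z, Star.star z, -Star.star z}

theorem Admissible.card_associates {z : EisensteinInt} (hz : Admissible z) (him : z.im ≠ 0) :
    (associates z).card = 4 := by
  have h1 : z ≠ Star.star z := fun h => him (by
    have := congrArg QuadraticAlgebra.im h
    rw [im_star] at this; omega)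
  have h2 : z ≠ -Star.star z := fun h => hz.2 (by
    have := congrArg QuadraticAlgebra.re h
    rw [re_neg, re_star] at this
    have hi : z.im = 2 * z.re := by linarith
    rw [norm_eq, hi]
    exact ⟨z.re ^ 2, by ring⟩)
  have h3 : z ≠ -z := fun h => him (by
    have := congrArg QuadraticAlgebra.im h
    rw [im_neg] at this; omega)
  have h4 : Star.star z ≠ -Star.star z := fun h => him (by
    have := congrArg QuadraticAlgebra.im h
    rw [im_neg, im_star] at this; omega)
  have h5 : -z ≠ Star.star z := fun h => h2 (by rw [← h, neg_neg])
  have h6 : -z ≠ -Star.star z := fun h => h1 (neg_injective h)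
  rw [associates, Finset.card_insert_of_notMem (by simp [h1, h2, h3]),
    Finset.card_insert_of_notMem (by simp [h5, h1]),
    Finset.card_insert_of_notMem (by simpa using h4), Finset.card_singleton]

theorem Model.mem_associates {z w : EisensteinInt} {L : Type*} [Field L] [NumberField L]
    (m : Model z L) (hz : Admissible z) (hw : Admissible w) (him : w.im ≠ 0) {u : L}
    (hu : IsCubicRoot w u) : w ∈ associates z := by
  obtain ⟨m', rfl⟩ := hw.exists_model him hu m.finrank_eq
  obtain ⟨p, q, r, hpqr⟩ := m.exists_eq hz.ne_zero m'.x
  have htr : Algebra.trace ℚ L m'.x = 0 := by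
    have := m'.trace_eq hw.ne_zero m'.x
    rw [m'.σx, m'.σy] at this
    have h0 : ((Algebra.trace ℚ L m'.x : ℚ) : L) = 0 := by rw [this]; ring
    exact_mod_cast h0
  have hp : p = 0 := by
    have := m.trace_eq hz.ne_zero m'.x
    rw [htr, hpqr] at this
    simp only [map_add, map_mul, map_ratCast, m.σx, m.σy, map_sub, map_neg] at this
    have h0 : (3 : L) * p = 0 := by push_cast at this; linear_combination -this
    simpa using h0
  rw [hp, Rat.cast_zero, zero_add] at hpqr
  have hcube : m'.x ^ 3 = 3 * (norm z : ℤ) * (q ^ 2 - q * r + r ^ 2) * m'.x +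
      (norm z : ℤ) * cubeTr (q : L) r z.re z.im := by
    have h1 := m.mul_conj_mul_conj 0 q r
    have h2 := m.mul_conj 0 q r
    have hxx := m.xx
    have hxy := m.xy
    have hyy := m.yy
    simp only [Rat.cast_zero] at h1 h2
    rw [hpqr]
    linear_combination h1 + (q * m.x + r * m.y : L) * (q ^ 2 - q * r + r ^ 2) * (hxx + hxy + hyy)
  rw [hu] at hcube
  have hrat : ((-((norm w : ℤ) * (tr w : ℤ)) + (norm z : ℤ) * cubeTr q r z.re z.im : ℚ) : L) +
      ((3 * ((norm z : ℤ) * (q ^ 2 - q * r + r ^ 2) - (norm w : ℤ)) : ℚ) : L) * m'.x +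
      ((0 : ℚ) : L) * m'.y = 0 := by
    simp only [cubeTr] at hcube ⊢
    push_cast
    linear_combination -hcube
  obtain ⟨hc0, hc1, -⟩ := m'.ratCast_eq_zero_of hw.ne_zero hrat
  obtain ⟨n, Q, R, hn, hQ, hR⟩ : ∃ n Q R : ℤ, n ≠ 0 ∧ (Q : ℚ) = n * q ∧ (R : ℚ) = n * r := by
    refine ⟨q.den * r.den, q.num * r.den, r.num * q.den, by positivity, ?_, ?_⟩
    · push_cast; rw [mul_right_comm, mul_comm (q.den : ℚ) q, Rat.mul_den_eq_num]
    · push_cast; rw [mul_assoc, mul_comm (r.den : ℚ) r, Rat.mul_den_eq_num, mul_comm]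
  obtain ⟨V, hV⟩ : ∃ V : EisensteinInt, V = ⟨Q, R⟩ := ⟨_, rfl⟩
  have hN : norm V * norm z = n ^ 2 * norm w := by
    have h : ((norm V * norm z : ℤ) : ℚ) = ((n ^ 2 * norm w : ℤ) : ℚ) := by
      rw [norm_eq V, hV]
      push_cast
      rw [hQ, hR]
      linear_combination (n ^ 2 : ℚ) * hc1 / 3
    exact_mod_cast h
  have hT : tr (V ^ 3 * (z ^ 2 * Star.star z)) =
      tr ((n : EisensteinInt) ^ 3 * (w ^ 2 * Star.star w)) := by
    rw [sq_mul_star, sq_mul_star, ← Int.cast_pow, tr_intCast_mul, tr_intCast_mul,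
      mul_left_comm, tr_intCast_mul, tr_cube_mul, hV]
    have h : ((norm z * cubeTr Q R z.re z.im : ℤ) : ℚ) =
        ((n ^ 3 * (norm w * tr w) : ℤ) : ℚ) := by
      simp only [cubeTr] at hc0 ⊢
      push_cast
      rw [hQ, hR]
      linear_combination (n ^ 3 : ℚ) * hc0
    exact_mod_cast h
  have hNn : norm (n : EisensteinInt) = n ^ 2 := by simp
  have hNN : norm (V ^ 3 * (z ^ 2 * Star.star z)) =
      norm ((n : EisensteinInt) ^ 3 * (w ^ 2 * Star.star w)) := by
    rw [map_mul QuadraticAlgebra.norm (V ^ 3), map_mul QuadraticAlgebra.norm ((n : EisensteinInt) ^ 3), norm_sq_mul_star,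
      norm_sq_mul_star, map_pow, map_pow, hNn, ← mul_pow,
      ← mul_pow, hN]
  have hn' : (n : EisensteinInt) ≠ 0 := by exact_mod_cast hn
  rw [associates]
  rcases eq_or_eq_star hT hNN with h | h
  · rcases hz.eq_or_eq_neg hw hn' (by rw [mul_comm, ← h, mul_comm]) with h | h <;> simp [h]
  · have h' : Star.star w ^ 2 * Star.star (Star.star w) * (n : EisensteinInt) ^ 3 =
        z ^ 2 * Star.star z * V ^ 3 := by
      rw [mul_comm _ (V ^ 3), h]
      rw [star_mul, star_mul, star_pow, star_pow, star_star, star_intCast]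
      ring
    rcases hz.eq_or_eq_neg hw.star hn' h' with h | h
    · have : w = Star.star z := by rw [← h, star_star]
      simp [this]
    · have : w = -Star.star z := by rw [← star_neg, ← h, star_star]
      simp [this]

theorem exists_root (K : Type*) [Field K] [Algebra ℚ K] [IsAlgClosed K] (z : EisensteinInt) :
    ∃ x : K, IsCubicRoot z x := by
  obtain ⟨x, hx⟩ := IsAlgClosed.exists_aeval_eq_zero K
    ((cubic z).map (algebraMap ℤ ℚ)) (by
      rw [(cubic_monic z).degree_map, Polynomial.degree_eq_natDegree (cubic_monic z).ne_zero,
        cubic_natDegree]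
      norm_num)
  refine ⟨x, ?_⟩
  rwa [Polynomial.aeval_map_algebraMap, aeval_cubic] at hx

/-- A root of the cubic attached to `z`. -/
noncomputable def root (z : EisensteinInt) : AlgebraicClosure ℚ :=
  (exists_root (AlgebraicClosure ℚ) z).choose

theorem isCubicRoot_root (z : EisensteinInt) : IsCubicRoot z (root z) :=
  (exists_root (AlgebraicClosure ℚ) z).choose_spec

/-- The field attached to `z`. -/
noncomputable def field (z : EisensteinInt) : IntermediateField ℚ (AlgebraicClosure ℚ) :=
  IntermediateField.adjoin ℚ {root z}

theorem root_mem_field (z : EisensteinInt) : root z ∈ field z :=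
  IntermediateField.mem_adjoin_simple_self ℚ (root z)

theorem isIntegral_root (z : EisensteinInt) : IsIntegral ℚ (root z) :=
  (isCubicRoot_root z).isIntegral.tower_top

instance (z : EisensteinInt) : FiniteDimensional ℚ (field z) :=
  IntermediateField.adjoin.finiteDimensional (isIntegral_root z)

theorem Admissible.finrank_field {z : EisensteinInt} (hz : Admissible z) (him : z.im ≠ 0) :
    Module.finrank ℚ (field z) = 3 := by
  rw [field, IntermediateField.adjoin.finrank (isIntegral_root z),
    hz.minpoly_eq him (isCubicRoot_root z), (cubic_monic z).natDegree_map, cubic_natDegree]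

instance (z : EisensteinInt) : NumberField (field z) := ⟨⟩

theorem IsCubicRoot.of_coe {L : IntermediateField ℚ (AlgebraicClosure ℚ)} {z : EisensteinInt}
    {x : L} (h : IsCubicRoot z (x : AlgebraicClosure ℚ)) : IsCubicRoot z x := by
  rw [IsCubicRoot] at h ⊢
  apply Subtype.coe_injective
  push_cast
  exact h

theorem Admissible.nonempty_model {z : EisensteinInt} (hz : Admissible z) (him : z.im ≠ 0) :
    Nonempty (Model z (field z)) := by
  obtain ⟨m, -⟩ := hz.exists_model him (x := (⟨root z, root_mem_field z⟩ : field z))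
    (IsCubicRoot.of_coe (isCubicRoot_root z)) (hz.finrank_field him)
  exact ⟨m⟩

/-- The absolute discriminant of the field attached to `z`. -/
def disc (z : EisensteinInt) : ℕ :=
  if 3 ∣ z.im then (norm z).natAbs ^ 2 else 81 * (norm z).natAbs ^ 2

theorem Admissible.absDisc_field {z : EisensteinInt} (hz : Admissible z) (him : z.im ≠ 0) :
    absDisc (field z) = disc z := by
  obtain ⟨m, hm⟩ := hz.exists_model him (x := (⟨root z, root_mem_field z⟩ : field z))
    (IsCubicRoot.of_coe (isCubicRoot_root z)) (hz.finrank_field him)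
  have hi : IsIntegral ℤ m.x := by
    rw [hm]
    exact (IsCubicRoot.of_coe (isCubicRoot_root z)).isIntegral
  rw [absDisc, dif_pos (inferInstance : FiniteDimensional ℚ (field z)), disc]
  split_ifs with h3
  · rw [m.discr_eq_of_dvd hz h3, Int.natAbs_pow]
  · rw [m.discr_eq_of_not_dvd hz h3 hi, Int.natAbs_mul, Int.natAbs_pow]
    rfl

theorem Model.field_eq {z w : EisensteinInt} {L : IntermediateField ℚ (AlgebraicClosure ℚ)}
    [NumberField L] (m : Model z L) (hw : Admissible w) (him : w.im ≠ 0)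
    (h : w ∈ associates z) : field w = L := by
  have key (u : AlgebraicClosure ℚ) (hu : IsCubicRoot z u) : u ∈ L := by
    have hxx := congrArg L.val m.xx
    have hxy := congrArg L.val m.xy
    have hyy := congrArg L.val m.yy
    simp only [map_add, map_mul, map_sub, map_neg, map_intCast, map_ofNat,
      IntermediateField.coe_val] at hxx hxy hyy
    have hprod : (u - m.x) * ((u - m.y) * (u + m.x + m.y)) = 0 := by
      rw [IsCubicRoot, tr_cast_eq] at hu
      rw [norm_cast_eq] at *
      linear_combination hu - u * (hxx + hxy + hyy) + (m.x + m.y : AlgebraicClosure ℚ) * hxy -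
        z.re * hxx + (z.im - 2 * z.re : AlgebraicClosure ℚ) * hxy +
        (z.im - z.re : AlgebraicClosure ℚ) * hyy
    rcases mul_eq_zero.1 hprod with h | h
    · rw [sub_eq_zero.1 h]; exact m.x.2
    · rcases mul_eq_zero.1 h with h | h
      · rw [sub_eq_zero.1 h]; exact m.y.2
      · have : u = ((-m.x - m.y : L) : AlgebraicClosure ℚ) := by
          push_cast; linear_combination h
        rw [this]; exact (-m.x - m.y : L).2
  have hmem : root w ∈ L := by
    have hr := isCubicRoot_root w
    rw [associates] at h
    simp only [Finset.mem_insert, Finset.mem_singleton] at h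
    rcases h with rfl | rfl | rfl | rfl
    · exact key _ hr
    · exact neg_mem_iff.1 (key _ (isCubicRoot_neg.1 hr))
    · exact key _ (isCubicRoot_star.1 hr)
    · exact neg_mem_iff.1 (key _ (isCubicRoot_star.1 (isCubicRoot_neg.1 hr)))
  apply IntermediateField.eq_of_le_of_finrank_eq
  · rw [field, IntermediateField.adjoin_simple_le_iff]
    exact hmem
  · rw [hw.finrank_field him, m.finrank_eq]

theorem Model.field_eq_iff {z w : EisensteinInt} {L : IntermediateField ℚ (AlgebraicClosure ℚ)}
    [NumberField L] (m : Model z L) (hz : Admissible z) (hw : Admissible w) (him : w.im ≠ 0) :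
    field w = L ↔ w ∈ associates z := by
  refine ⟨?_, m.field_eq hw him⟩
  rintro rfl
  exact m.mem_associates hz hw him (u := (⟨root w, root_mem_field w⟩ : field w))
    (IsCubicRoot.of_coe (isCubicRoot_root w))

theorem mem_associates_self (z : EisensteinInt) : z ∈ associates z := by
  simp [associates]

theorem exists_field_eq {L : IntermediateField ℚ (AlgebraicClosure ℚ)}
    (hfin : FiniteDimensional ℚ L) (hgal : IsGalois ℚ L)
    (he : Nonempty ((L ≃ₐ[ℚ] L) ≃* Multiplicative (ZMod 3))) :
    ∃ z, Admissible z ∧ z.im ≠ 0 ∧ field z = L := by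
  obtain ⟨e⟩ := he
  have : NumberField L := ⟨⟩
  have hrank : Module.finrank ℚ L = 3 := by
    rw [← IsGalois.card_aut_eq_finrank, Nat.card_congr e.toEquiv]
    simp
  obtain ⟨σ, hσ⟩ : ∃ σ : L ≃ₐ[ℚ] L, e σ = Multiplicative.ofAdd 1 := e.surjective _
  have hgen (τ : L ≃ₐ[ℚ] L) : ∃ k : ℕ, τ = σ ^ k := by
    refine ⟨(Multiplicative.toAdd (e τ)).val, e.injective ?_⟩
    rw [map_pow, hσ, ← ofAdd_nsmul, nsmul_one, ZMod.natCast_val, ZMod.cast_id', id,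
      ofAdd_toAdd]
  have hσ3 : σ ^ 3 = 1 := e.injective (by
    rw [map_pow, hσ, map_one e]
    decide)
  have h3 (u : L) : σ (σ (σ u)) = u := by
    have := congrArg (fun τ : L ≃ₐ[ℚ] L => τ u) hσ3
    simpa [pow_succ, AlgEquiv.mul_apply] using this
  have hfix (u : L) (hu : σ u = u) : ∃ r : ℚ, u = r := by
    have : u ∈ (⊥ : IntermediateField ℚ L) := by
      rw [IsGalois.mem_bot_iff_fixed]
      intro τ
      obtain ⟨k, rfl⟩ := hgen τ
      induction k with
      | zero => rfl
      | succ k ih => rw [pow_succ, AlgEquiv.mul_apply, hu, ih]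
    obtain ⟨r, hr⟩ := IntermediateField.mem_bot.1 this
    exact ⟨r, by rw [← hr, eq_ratCast]⟩
  obtain ⟨t, ht, hσt⟩ : ∃ t : L, IsIntegral ℤ t ∧ σ t ≠ t := by
    by_contra! h
    have hσ1 : σ = 1 := by
      ext u
      obtain ⟨v, d, hd, rfl⟩ := IsFractionRing.div_surjective (A := NumberField.RingOfIntegers L) u
      rw [map_div₀, AlgEquiv.one_apply, h _ (NumberField.RingOfIntegers.isIntegral_coe v),
        h _ (NumberField.RingOfIntegers.isIntegral_coe d)]
    rw [hσ1, map_one] at hσ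
    revert hσ
    decide
  obtain ⟨z, x, hz, him, hx, -⟩ := exists_isCubicRoot σ h3 hfix ht hσt
  obtain ⟨m, -⟩ := hz.exists_model him hx hrank
  exact ⟨z, hz, him, m.field_eq hz him (mem_associates_self z)⟩

theorem four_mul_galoisCount (X : ℝ) : 4 * galoisCount (Multiplicative (ZMod 3)) X =
    {z : EisensteinInt | Admissible z ∧ z.im ≠ 0 ∧ (disc z : ℝ) ≤ X}.ncard := by
  have hfin : {z : EisensteinInt | Admissible z ∧ z.im ≠ 0 ∧ (disc z : ℝ) ≤ X}.Finite := by
    apply ((Set.finite_Icc (0 : ℤ) ⌊X⌋₊).biUnion fun n _ => finite_norm_eq n).subset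
    rintro z ⟨-, -, hX⟩
    have hn := norm_nonneg z
    have hle : (norm z).natAbs ≤ disc z := by
      rw [disc]
      split_ifs <;> nlinarith [(Nat.zero_le (norm z).natAbs)]
    have := hle.trans (Nat.le_floor hX)
    simp only [Set.mem_iUnion]
    exact ⟨norm z, ⟨hn, by omega⟩, rfl⟩
  have himage : {L : IntermediateField ℚ (AlgebraicClosure ℚ) | FiniteDimensional ℚ L ∧
      IsGalois ℚ L ∧ Nonempty ((L ≃ₐ[ℚ] L) ≃* Multiplicative (ZMod 3)) ∧ (absDisc L : ℝ) ≤ X} =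
      (hfin.toFinset.image field : Finset _) := by
    ext L
    simp only [Finset.coe_image, Set.Finite.coe_toFinset, Set.mem_image, Set.mem_ofPred_eq]
    constructor
    · rintro ⟨h1, h2, h3, h4⟩
      obtain ⟨z, hz, him, rfl⟩ := exists_field_eq h1 h2 h3
      rw [hz.absDisc_field him] at h4
      exact ⟨z, ⟨hz, him, h4⟩, rfl⟩
    · rintro ⟨z, ⟨hz, him, hX⟩, rfl⟩
      obtain ⟨m⟩ := hz.nonempty_model him
      refine ⟨inferInstance, m.isGalois hz.ne_zero, m.nonempty_mulEquiv hz.ne_zero, ?_⟩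
      rwa [hz.absDisc_field him]
  rw [galoisCount, ← Set.coe_ofPred, Nat.card_coe_set_eq, himage, Set.ncard_coe_finset,
    Set.ncard_eq_toFinset_card _ hfin, Finset.card_eq_sum_card_image field,
    Finset.sum_const_nat (m := 4), mul_comm]
  intro L hL
  simp only [Finset.mem_image, Set.Finite.mem_toFinset, Set.mem_ofPred_eq] at hL
  obtain ⟨z, ⟨hz, him, hX⟩, rfl⟩ := hL
  obtain ⟨m⟩ := hz.nonempty_model him
  rw [← hz.card_associates him]
  congr 1
  ext w
  simp only [Finset.mem_filter, Set.Finite.mem_toFinset, Set.mem_ofPred_eq]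
  constructor
  · rintro ⟨⟨hw, hwi, -⟩, h⟩
    exact (m.field_eq_iff hz hw hwi).1 h
  · intro h
    have hw : Admissible w ∧ w.im ≠ 0 := by
      rw [associates] at h
      simp only [Finset.mem_insert, Finset.mem_singleton] at h
      rcases h with rfl | rfl | rfl | rfl
      · exact ⟨hz, him⟩
      · exact ⟨hz.neg, by simpa using him⟩
      · exact ⟨hz.star, by simpa using him⟩
      · exact ⟨hz.star.neg, by simpa using him⟩
    have heq := (m.field_eq_iff hz hw.1 hw.2).2 h
    refine ⟨⟨hw.1, hw.2, ?_⟩, heq⟩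
    rwa [← hw.1.absDisc_field hw.2, heq, hz.absDisc_field him]

/-- The number of admissible elements of norm `n`, divided by six. -/
noncomputable def coeff (n : ℕ) : ℕ :=
  if Squarefree n ∧ ¬ 3 ∣ n then ∏ p ∈ n.primeFactors, if p % 3 = 1 then 2 else 0 else 0

theorem finite_admissible (P : EisensteinInt → Prop) (N : ℕ) :
    {z : EisensteinInt | Admissible z ∧ P z ∧ norm z ≤ N}.Finite := by
  apply ((Set.finite_Icc (0 : ℤ) N).biUnion fun n _ => finite_norm_eq n).subset
  rintro z ⟨-, -, hX⟩
  simp only [Set.mem_iUnion]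
  exact ⟨norm z, ⟨norm_nonneg z, hX⟩, rfl⟩

theorem ncard_admissible (P : EisensteinInt → Prop) (N : ℕ) :
    {z : EisensteinInt | Admissible z ∧ P z ∧ norm z ≤ N}.ncard = ∑ n ∈ Finset.Icc 1 N,
      if Squarefree n ∧ ¬ 3 ∣ n then {z : EisensteinInt | norm z = n ∧ P z}.ncard else 0 := by
  have hfin := finite_admissible P N
  rw [Set.ncard_eq_toFinset_card _ hfin, Finset.card_eq_sum_card_fiberwise
    (f := fun z => (norm z).toNat) (t := Finset.Icc 1 N)]
  · apply Finset.sum_congr rfl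
    intro n hn
    rw [Finset.mem_Icc] at hn
    have hset (h : Squarefree n ∧ ¬ 3 ∣ n) : ((Finset.filter (fun z => (norm z).toNat = n)
        hfin.toFinset : Finset EisensteinInt) : Set EisensteinInt) =
        {z : EisensteinInt | norm z = n ∧ P z} := by
      ext z
      have := norm_nonneg z
      simp only [Finset.coe_filter, Set.Finite.mem_toFinset, Set.mem_ofPred_eq]
      constructor
      · rintro ⟨⟨-, hP, -⟩, h⟩
        exact ⟨by omega, hP⟩
      · rintro ⟨hn', hP⟩
        refine ⟨⟨⟨?_, ?_⟩, hP, by omega⟩, by omega⟩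
        · rw [hn', Int.squarefree_natCast]
          exact h.1
        · rw [hn']
          exact_mod_cast h.2
    split_ifs with h
    · rw [← hset h, Set.ncard_coe_finset]
    · rw [Finset.card_eq_zero, Finset.filter_eq_empty_iff]
      intro z hz hzn
      rw [Set.Finite.mem_toFinset] at hz
      have hn0 : norm z = n := by
        have := norm_nonneg z
        omega
      obtain ⟨⟨h1, h2⟩, -⟩ := hz
      rw [hn0] at h1 h2
      exact h ⟨Int.squarefree_natCast.1 h1, by exact_mod_cast h2⟩
  · intro z hz
    rw [Finset.mem_coe, Set.Finite.mem_toFinset] at hz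
    obtain ⟨hz, -, hN⟩ := hz
    have := norm_pos hz.ne_zero
    rw [Finset.mem_coe, Finset.mem_Icc]
    dsimp only
    omega

theorem ncard_primary {n : ℕ} (h : Squarefree n ∧ ¬ 3 ∣ n) :
    {z : EisensteinInt | norm z = n ∧ 3 ∣ z.im}.ncard = 2 * coeff n := by
  have h1 := three_mul_ncard_primary (n := n) (by exact_mod_cast h.2)
  have h2 := normCount_eq h.1 h.2
  rw [coeff, if_pos h]
  omega

theorem ncard_not_primary {n : ℕ} (h : Squarefree n ∧ ¬ 3 ∣ n) :
    {z : EisensteinInt | norm z = n ∧ ¬ 3 ∣ z.im}.ncard = 4 * coeff n := by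
  have h1 := ncard_primary h
  have h2 : normCount n = 6 * coeff n := by rw [coeff, if_pos h, normCount_eq h.1 h.2]
  have h3 := Set.ncard_inter_add_ncard_sdiff_eq_ncard {z : EisensteinInt | norm z = n}
    {z : EisensteinInt | 3 ∣ z.im} (finite_norm_eq n)
  change Set.ncard {z : EisensteinInt | norm z = n ∧ 3 ∣ z.im} +
    Set.ncard {z : EisensteinInt | norm z = n ∧ ¬ 3 ∣ z.im} = normCount n at h3
  omega

theorem coeff_eq_zero {n : ℕ} (h : ¬ (Squarefree n ∧ ¬ 3 ∣ n)) : coeff n = 0 := if_neg h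

theorem two_mul_galoisCount {X : ℝ} (hX : 1 ≤ X) :
    2 * galoisCount (Multiplicative (ZMod 3)) X + 1 =
      ∑ n ∈ Finset.Icc 1 ⌊√X⌋₊, coeff n + 2 * ∑ n ∈ Finset.Icc 1 ⌊√X / 9⌋₊, coeff n := by
  have h := four_mul_galoisCount X
  have hs : 1 ≤ √X := Real.one_le_sqrt.2 hX
  have hP := ncard_admissible (fun z => 3 ∣ z.im) ⌊√X⌋₊
  have hQ := ncard_admissible (fun z => ¬ 3 ∣ z.im) ⌊√X / 9⌋₊
  rw [Finset.sum_congr rfl (g := fun n => 2 * coeff n) (fun n _ => by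
    split_ifs with h
    · exact ncard_primary h
    · rw [coeff_eq_zero h]), ← Finset.mul_sum] at hP
  rw [Finset.sum_congr rfl (g := fun n => 4 * coeff n) (fun n _ => by
    split_ifs with h
    · exact ncard_not_primary h
    · rw [coeff_eq_zero h]), ← Finset.mul_sum] at hQ
  have hle (z : EisensteinInt) (Y : ℝ) (hY : 0 ≤ Y) :
      norm z ≤ ⌊Y⌋₊ ↔ (((norm z).natAbs : ℕ) : ℝ) ≤ Y := by
    rw [← Nat.le_floor_iff hY]
    have := norm_nonneg z
    omega
  have hfS : {z : EisensteinInt | Admissible z ∧ z.im ≠ 0 ∧ (disc z : ℝ) ≤ X} ∪ {1, -1} =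
      {z : EisensteinInt | Admissible z ∧ 3 ∣ z.im ∧ norm z ≤ ⌊√X⌋₊} ∪
      {z : EisensteinInt | Admissible z ∧ ¬ 3 ∣ z.im ∧ norm z ≤ ⌊√X / 9⌋₊} := by
    have h1 : Admissible 1 := by simp [Admissible]
    have hdiscP (z : EisensteinInt) (h3 : 3 ∣ z.im) : (disc z : ℝ) ≤ X ↔ norm z ≤ ⌊√X⌋₊ := by
      rw [hle _ _ (by positivity), Real.le_sqrt (by positivity) (by positivity), disc, if_pos h3]
      push_cast
      rfl
    have hdiscQ (z : EisensteinInt) (h3 : ¬ 3 ∣ z.im) :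
        (disc z : ℝ) ≤ X ↔ norm z ≤ ⌊√X / 9⌋₊ := by
      rw [hle _ _ (by positivity), le_div_iff₀ (by norm_num),
        Real.le_sqrt (by positivity) (by positivity), disc, if_neg h3, mul_pow]
      push_cast
      rw [mul_comm]
      norm_num
    ext z
    simp only [Set.mem_union, Set.mem_ofPred_eq, Set.mem_insert_iff, Set.mem_singleton_iff]
    constructor
    · rintro (⟨hz, -, hd⟩ | rfl | rfl)
      · by_cases h3 : 3 ∣ z.im
        · exact Or.inl ⟨hz, h3, (hdiscP z h3).1 hd⟩
        · exact Or.inr ⟨hz, h3, (hdiscQ z h3).1 hd⟩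
      · exact Or.inl ⟨h1, by simp, (hle _ _ (by positivity)).2 (by simpa using hX)⟩
      · refine Or.inl ⟨h1.neg, by simp, (hle _ _ (by positivity)).2 ?_⟩
        rw [norm_neg']
        simpa using hX
    · rintro (⟨hz, h3, hn⟩ | ⟨hz, h3, hn⟩)
      · by_cases him : z.im = 0
        · right
          have hsq := hz.1
          rw [norm_eq, him] at hsq
          have hu : IsUnit z.re := hsq _ ⟨1, by ring⟩
          rcases Int.isUnit_iff.1 hu with h | h
          · left; ext <;> simp [h, him]
          · right; ext <;> simp [h, him]
        · exact Or.inl ⟨hz, him, (hdiscP z h3).2 hn⟩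
      · refine Or.inl ⟨hz, fun h0 => h3 (by simp [h0]), (hdiscQ z h3).2 hn⟩
  have hPf := finite_admissible (fun z => 3 ∣ z.im) ⌊√X⌋₊
  have hQf := finite_admissible (fun z => ¬ 3 ∣ z.im) ⌊√X / 9⌋₊
  have hcard := congrArg Set.ncard hfS
  have hfin := (Set.finite_union.1 (hfS ▸ hPf.union hQf)).1
  rw [Set.ncard_union_eq _ hPf hQf, Set.ncard_union_eq _ hfin, Set.ncard_pair, hP, hQ, ← h]
    at hcard
  · omega
  · intro h
    have := congrArg QuadraticAlgebra.re h
    simp at this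
  · rw [Set.disjoint_right]
    rintro z (rfl | rfl) ⟨-, h0, -⟩
    · simp at h0
    · simp at h0
  · rw [Set.disjoint_right]
    rintro z ⟨-, h0, -⟩ ⟨-, h1, -⟩
    exact h0 h1

end EisensteinInt

namespace EisensteinInt

open ArithmeticFunction Finset
open scoped ArithmeticFunction.zeta ArithmeticFunction.sigma

/-- The nontrivial Dirichlet character modulo 3. -/
noncomputable def chi : ArithmeticFunction ℝ :=
  ⟨fun n => if n % 3 = 1 then 1 else if n % 3 = 2 then -1 else 0, rfl⟩

theorem chi_apply (n : ℕ) : chi n = if n % 3 = 1 then 1 else if n % 3 = 2 then -1 else 0 := rfl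

theorem abs_sum_chi_mul_le {b : ℕ → ℝ} {D : ℕ} (hb0 : ∀ d, D < d → 0 ≤ b d)
    (hb : ∀ d, D < d → b (d + 1) ≤ b d) (N : ℕ) :
    |∑ d ∈ Ioc D N, chi d * b d| ≤ b (D + 1) := by
  let S : ℕ → ℝ := fun n => if n % 3 = 1 then 1 else 0
  have hS (n : ℕ) : S (n + 1) = S n + chi (n + 1) := by
    have h := Nat.mod_lt n (show 3 > 0 by norm_num)
    simp only [S, chi_apply]
    interval_cases h3 : n % 3 <;> simp [Nat.add_mod, h3]
  have hS0 (n : ℕ) : 0 ≤ S n ∧ S n ≤ 1 := by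
    simp only [S]; split_ifs <;> norm_num
  rcases lt_or_ge N D with h | h
  · rw [Ioc_eq_empty_of_le h.le, sum_empty, abs_zero]
    exact hb0 _ (Nat.lt_succ_self D)
  have key : |∑ d ∈ Ioc D N, chi d * b d - (S N - S D) * b (N + 1)| ≤ b (D + 1) - b (N + 1) := by
    induction N, h using Nat.le_induction with
    | base => simp
    | succ N hN ih =>
      rw [sum_Ioc_succ_top hN]
      have h1 := hb (N + 1) (by omega)
      have h2 : ∑ d ∈ Ioc D N, chi d * b d + chi (N + 1) * b (N + 1) -
          (S (N + 1) - S D) * b (N + 1 + 1) = (∑ d ∈ Ioc D N, chi d * b d -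
          (S N - S D) * b (N + 1)) + (S (N + 1) - S D) * (b (N + 1) - b (N + 1 + 1)) := by
        rw [hS]; ring
      rw [h2]
      have h3 : |(S (N + 1) - S D) * (b (N + 1) - b (N + 1 + 1))| ≤ b (N + 1) - b (N + 1 + 1) := by
        rw [abs_mul, abs_of_nonneg (sub_nonneg.2 h1)]
        apply mul_le_of_le_one_left (sub_nonneg.2 h1)
        rw [abs_le]
        constructor <;> linarith [hS0 (N + 1), hS0 D]
      linarith [abs_add_le (∑ d ∈ Ioc D N, chi d * b d - (S N - S D) * b (N + 1))
        ((S (N + 1) - S D) * (b (N + 1) - b (N + 1 + 1)))]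
  have h0 := hb0 (N + 1) (by omega)
  have h3 : |(S N - S D) * b (N + 1)| ≤ b (N + 1) := by
    rw [abs_mul, abs_of_nonneg h0]
    apply mul_le_of_le_one_left h0
    rw [abs_le]
    constructor <;> linarith [hS0 N, hS0 D]
  have := abs_add_le (∑ d ∈ Ioc D N, chi d * b d - (S N - S D) * b (N + 1)) ((S N - S D) * b (N + 1))
  rw [sub_add_cancel] at this
  linarith

theorem exists_sum_chi_div : ∃ L : ℝ, ∀ D : ℕ,
    |∑ d ∈ Ioc 0 D, chi d * (1 / (d : ℝ)) - L| ≤ 1 / ((D : ℝ) + 1) := by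
  have key (n m : ℕ) (h : n ≤ m) : |∑ d ∈ Ioc 0 n, chi d * (1 / (d : ℝ)) -
      ∑ d ∈ Ioc 0 m, chi d * (1 / (d : ℝ))| ≤ 1 / ((n : ℝ) + 1) := by
    rw [abs_sub_comm, ← sum_Ioc_consecutive _ (Nat.zero_le n) h, add_sub_cancel_left]
    have := abs_sum_chi_mul_le (b := fun d : ℕ => 1 / (d : ℝ)) (D := n)
      (fun d _ => by positivity) (fun d hd => by
        have : (0 : ℝ) < d := by exact_mod_cast (Nat.zero_le n).trans_lt hd
        apply one_div_le_one_div_of_le this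
        push_cast; linarith) m
    push_cast at this
    exact this
  have hc : CauchySeq fun D : ℕ => ∑ d ∈ Ioc 0 D, chi d * (1 / (d : ℝ)) :=
    cauchySeq_of_le_tendsto_0' _ key tendsto_one_div_add_atTop_nhds_zero_nat
  obtain ⟨L, hL⟩ := cauchySeq_tendsto_of_complete hc
  refine ⟨L, fun D => ?_⟩
  exact le_of_tendsto (hL.const_sub _).abs
    (Filter.eventually_atTop.2 ⟨D, fun m hm => key D m hm⟩)

/-- The number of ideals of norm `n` in the Eisenstein integers. -/
noncomputable def idealCount : ArithmeticFunction ℝ := chi * ζ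

theorem abs_sum_idealCount_sub_le {L : ℝ} (hL : ∀ D : ℕ,
    |∑ d ∈ Ioc 0 D, chi d * (1 / (d : ℝ)) - L| ≤ 1 / ((D : ℝ) + 1)) (N : ℕ) :
    |∑ n ∈ Ioc 0 N, idealCount n - L * N| ≤ 3 * √N := by
  rcases Nat.eq_zero_or_pos N with rfl | hN
  · simp
  have hNpos : (0 : ℝ) < N := by exact_mod_cast hN
  obtain ⟨D, hD⟩ : ∃ D, D = Nat.sqrt N := ⟨_, rfl⟩
  have hDN : D ≤ N := hD ▸ Nat.sqrt_le_self N
  have hD1 : (D : ℝ) ≤ √N := hD ▸ Real.nat_sqrt_le_real_sqrt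
  have hD2 : √N < D + 1 := hD ▸ Real.real_sqrt_lt_nat_sqrt_succ
  have hdiv : (N : ℝ) / (D + 1) ≤ √N := by
    rw [div_le_iff₀ (by positivity)]
    nlinarith [Real.mul_self_sqrt hNpos.le, Real.sqrt_nonneg (N : ℝ)]
  rw [idealCount, sum_Ioc_mul_zeta_eq_sum, ← sum_Ioc_consecutive _ (Nat.zero_le D) hDN]
  have htail := abs_sum_chi_mul_le (b := fun d : ℕ => ((N / d : ℕ) : ℝ)) (D := D)
    (fun d _ => by positivity) (fun d hd => by
      exact_mod_cast Nat.div_le_div_left (Nat.le_succ d) (by omega)) N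
  have htail' : ((N / (D + 1) : ℕ) : ℝ) ≤ √N := Nat.cast_div_le.trans (by push_cast; exact hdiv)
  have hhead : |∑ d ∈ Ioc 0 D, chi d * ((N / d : ℕ) : ℝ) -
      N * ∑ d ∈ Ioc 0 D, chi d * (1 / (d : ℝ))| ≤ D := by
    rw [mul_sum, ← sum_sub_distrib]
    refine (abs_sum_le_sum_abs _ _).trans ?_
    have : ∀ d ∈ Ioc 0 D, |chi d * ((N / d : ℕ) : ℝ) - N * (chi d * (1 / (d : ℝ)))| ≤ 1 := by
      intro d hd
      rw [mem_Ioc] at hd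
      have hd0 : (0 : ℝ) < d := by exact_mod_cast hd.1
      have h1 : chi d * ((N / d : ℕ) : ℝ) - N * (chi d * (1 / (d : ℝ))) =
          chi d * (((N / d : ℕ) : ℝ) - N / d) := by ring
      have h2 : |chi d| ≤ 1 := by
        rw [chi_apply]; split_ifs <;> simp
      have h3 : |((N / d : ℕ) : ℝ) - N / d| ≤ 1 := by
        have h4 : ((N / d : ℕ) : ℝ) ≤ N / d := Nat.cast_div_le
        have h5 : (N : ℝ) / d < (N / d : ℕ) + 1 := by
          rw [div_lt_iff₀ hd0]
          rw [mul_comm]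
          exact_mod_cast Nat.lt_mul_div_succ N hd.1
        rw [abs_le]
        constructor <;> linarith
      rw [h1, abs_mul]
      exact mul_le_one₀ h2 (abs_nonneg _) h3
    refine (sum_le_sum this).trans ?_
    simp
  have hmid : |N * ∑ d ∈ Ioc 0 D, chi d * (1 / (d : ℝ)) - L * N| ≤ √N := by
    rw [mul_comm L, ← mul_sub, abs_mul, abs_of_pos hNpos]
    refine (mul_le_mul_of_nonneg_left (hL D) hNpos.le).trans ?_
    rwa [mul_one_div]
  rw [abs_le] at *
  constructor <;> linarith

theorem exists_sum_idealCount : ∃ L C : ℝ, 0 ≤ C ∧ ∀ y s : ℝ, 0 < y → 1 / 2 ≤ s → s ≤ 1 →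
    |∑ n ∈ Ioc 0 ⌊y⌋₊, idealCount n - L * y| ≤ C * y ^ s := by
  obtain ⟨L, hL⟩ := exists_sum_chi_div
  refine ⟨L, 3 + |L|, by positivity, fun y s hy hs hs1 => ?_⟩
  rcases lt_or_ge y 1 with h | h
  · rw [Nat.floor_eq_zero.2 h, Ioc_self, sum_empty, zero_sub, abs_neg, abs_mul, abs_of_pos hy]
    have h1 : y ≤ y ^ s := by
      conv_lhs => rw [← Real.rpow_one y]
      exact Real.rpow_le_rpow_of_exponent_ge hy h.le hs1
    nlinarith [abs_nonneg L, Real.rpow_nonneg hy.le s]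
  · have h1 := abs_sum_idealCount_sub_le hL ⌊y⌋₊
    have h2 : √(⌊y⌋₊ : ℝ) ≤ y ^ s := by
      refine (Real.sqrt_le_sqrt (Nat.floor_le hy.le)).trans ?_
      rw [Real.sqrt_eq_rpow]
      exact Real.rpow_le_rpow_of_exponent_le h hs
    have h3 : |L * ⌊y⌋₊ - L * y| ≤ |L| * y ^ s := by
      rw [← mul_sub, abs_mul]
      apply mul_le_mul_of_nonneg_left _ (abs_nonneg L)
      have : 1 ≤ y ^ s := Real.one_le_rpow h (by linarith)
      rw [abs_le]
      constructor <;> linarith [Nat.floor_le hy.le, Nat.lt_floor_add_one y]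
    rw [abs_le] at *
    constructor <;> nlinarith

theorem isMultiplicative_chi : chi.IsMultiplicative := by
  refine ⟨by simp [chi_apply], fun {m n} _ => ?_⟩
  have hm := Nat.mod_lt m (show 3 > 0 by norm_num)
  have hn := Nat.mod_lt n (show 3 > 0 by norm_num)
  simp only [chi_apply, Nat.mul_mod m n]
  interval_cases m % 3 <;> interval_cases n % 3 <;> norm_num

theorem isMultiplicative_idealCount : idealCount.IsMultiplicative :=
  isMultiplicative_chi.mul isMultiplicative_zeta.natCast

theorem idealCount_prime_pow {p : ℕ} (hp : p.Prime) (k : ℕ) : idealCount (p ^ k) =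
    if p % 3 = 1 then (k : ℝ) + 1 else if p % 3 = 2 then (if k % 2 = 0 then 1 else 0) else 1 := by
  rw [idealCount, coe_mul_zeta_apply, Nat.sum_divisors_prime_pow hp]
  have h := Nat.mod_lt p (show 3 > 0 by norm_num)
  induction k with
  | zero =>
    simp [chi_apply]
  | succ k ih =>
    rw [sum_range_succ, ih, chi_apply, Nat.pow_mod]
    interval_cases h3 : p % 3
    · simp
    · simp
    · have h4 : 2 ^ (k + 1) % 3 = if k % 2 = 0 then 2 else 1 := by
        clear ih
        induction k with
        | zero => rfl
        | succ k ih =>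
          rw [pow_succ, Nat.mul_mod, ih]
          split_ifs <;> first | rfl | omega
      rw [h4]
      have : (k + 1) % 2 = 0 ↔ ¬ k % 2 = 0 := by omega
      by_cases hk : k % 2 = 0 <;> simp [this, hk]

/-- The arithmetic function with value `∏ p, t p (v_p n)` at `n ≠ 0`. -/
noncomputable def ofPrimePow (t : ℕ → ℕ → ℝ) : ArithmeticFunction ℝ :=
  ⟨fun n => if n = 0 then 0 else n.factorization.prod t, if_pos rfl⟩

theorem ofPrimePow_apply (t : ℕ → ℕ → ℝ) {n : ℕ} (hn : n ≠ 0) :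
    ofPrimePow t n = n.factorization.prod t := if_neg hn

theorem isMultiplicative_ofPrimePow (t : ℕ → ℕ → ℝ) : (ofPrimePow t).IsMultiplicative := by
  rw [IsMultiplicative.iff_ne_zero]
  refine ⟨by simp [ofPrimePow_apply], fun {m n} hm hn h => ?_⟩
  rw [ofPrimePow_apply t (mul_ne_zero hm hn), ofPrimePow_apply t hm, ofPrimePow_apply t hn,
    Nat.factorization_mul_of_coprime h,
    Finsupp.prod_add_index_of_disjoint (Nat.Coprime.disjoint_primeFactors h)]

theorem ofPrimePow_prime_pow {t : ℕ → ℕ → ℝ} (ht : ∀ p, t p 0 = 1) {p : ℕ} (hp : p.Prime) (k : ℕ) :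
    ofPrimePow t (p ^ k) = t p k := by
  rw [ofPrimePow_apply t (pow_ne_zero k hp.ne_zero), hp.factorization_pow,
    Finsupp.prod_single_index (ht p)]

/-- `coeff` as a real arithmetic function. -/
noncomputable def realCoeff : ArithmeticFunction ℝ :=
  ⟨fun n => coeff n, by simp [coeff]⟩

theorem realCoeff_apply (n : ℕ) : realCoeff n = coeff n := rfl

theorem isMultiplicative_realCoeff : realCoeff.IsMultiplicative := by
  rw [IsMultiplicative.iff_ne_zero]
  refine ⟨by simp [realCoeff_apply, coeff], fun {m n} hm hn h => ?_⟩
  simp only [realCoeff_apply, coeff, Nat.squarefree_mul h, Nat.prime_three.dvd_mul,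
    h.primeFactors_mul, prod_union h.disjoint_primeFactors]
  by_cases h1 : Squarefree m <;> by_cases h2 : Squarefree n <;> by_cases h3 : 3 ∣ m <;>
    by_cases h4 : 3 ∣ n <;> simp [h1, h2, h3, h4]

theorem realCoeff_prime_pow {p : ℕ} (hp : p.Prime) (k : ℕ) : realCoeff (p ^ k) =
    if k = 0 then 1 else if k = 1 ∧ p % 3 = 1 then 2 else 0 := by
  rw [realCoeff_apply, coeff]
  rcases k with _ | _ | k
  · simp
  · have : 3 ∣ p → ¬ p % 3 = 1 := by omega
    by_cases h3 : p % 3 = 1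
    · have : ¬ 3 ∣ p := by omega
      simp [hp.squarefree, hp.primeFactors, h3, this]
    · simp [hp.squarefree, hp.primeFactors, h3]
  · have : ¬ Squarefree (p ^ (k + 1 + 1)) := by
      rw [Nat.squarefree_pow_iff hp.ne_one (by omega)]
      omega
    simp [this]

/-- The values of `corr` at prime powers. -/
noncomputable def corrTable (p k : ℕ) : ℝ :=
  if k = 0 then 1 else if p % 3 = 1 then (if k = 2 then -3 else if k = 3 then 2 else 0)
  else if p % 3 = 2 then (if k = 2 then -1 else 0) else if k = 1 then -1 else 0

/-- The Dirichlet quotient of `realCoeff` by `idealCount`. -/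
noncomputable def corr : ArithmeticFunction ℝ := ofPrimePow corrTable

theorem corr_prime_pow {p : ℕ} (hp : p.Prime) (k : ℕ) : corr (p ^ k) = corrTable p k :=
  ofPrimePow_prime_pow (by simp [corrTable]) hp k

theorem isMultiplicative_corr : corr.IsMultiplicative := isMultiplicative_ofPrimePow _

theorem realCoeff_eq : realCoeff = corr * idealCount := by
  rw [IsMultiplicative.eq_iff_eq_on_prime_powers _ isMultiplicative_realCoeff _
    (isMultiplicative_corr.mul isMultiplicative_idealCount)]
  intro p i hp
  have hsum : (corr * idealCount) (p ^ i) =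
      ∑ k ∈ range (i + 1), corrTable p k * idealCount (p ^ (i - k)) := by
    rw [mul_apply, Nat.sum_divisorsAntidiagonal (fun x y => corr x * idealCount y),
      Nat.sum_divisors_prime_pow hp]
    refine sum_congr rfl fun k hk => ?_
    rw [corr_prime_pow hp, Nat.pow_div (by simpa [Nat.lt_succ_iff] using hk) hp.pos]
  rw [hsum, realCoeff_prime_pow hp]
  simp only [idealCount_prime_pow hp]
  have h := Nat.mod_lt p (show 3 > 0 by norm_num)
  obtain _ | _ | _ | _ | i := i
  · simp [corrTable]
  · interval_cases h3 : p % 3 <;> norm_num [sum_range_succ, corrTable, h3]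
  · interval_cases h3 : p % 3 <;> norm_num [sum_range_succ, corrTable, h3]
  · interval_cases h3 : p % 3 <;> norm_num [sum_range_succ, corrTable, h3]
  · rw [show i + 1 + 1 + 1 + 1 + 1 = 4 + (i + 1) by ring, sum_range_add]
    have htail : ∑ x ∈ range (i + 1), corrTable p (4 + x) * (if p % 3 = 1 then
      ((i + 1 + 1 + 1 + 1 - (4 + x) : ℕ) : ℝ) + 1 else if p % 3 = 2 then
      (if (i + 1 + 1 + 1 + 1 - (4 + x)) % 2 = 0 then 1 else 0) else 1) = 0 := by
      apply sum_eq_zero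
      intro x _
      have h2 : 4 + x ≠ 1 := by omega
      have h3 : 4 + x ≠ 2 := by omega
      have h4 : 4 + x ≠ 3 := by omega
      simp [corrTable, h2, h3, h4]
    rw [htail]
    interval_cases h3 : p % 3
    · norm_num [sum_range_succ, corrTable, h3]
    · have h2 : i + 1 + 1 + 1 + 1 - 2 = i + 2 := by omega
      have h5 : i + 1 + 1 + 1 + 1 - 3 = i + 1 := by omega
      norm_num [sum_range_succ, corrTable, h3, h2, h5]
      ring
    · have h2 : i + 1 + 1 + 1 + 1 - 2 = i + 2 := by omega
      have h5 : (i + 1 + 1 + 1 + 1) % 2 = i % 2 := by omega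
      norm_num [sum_range_succ, corrTable, h3, h2, h5]
      split_ifs <;> norm_num

theorem idealCount_nonneg (n : ℕ) : 0 ≤ idealCount n := by
  induction n using Nat.recOnPosPrimePosCoprime with
  | prime_pow p k hp hk =>
    rw [idealCount_prime_pow hp]
    split_ifs <;> positivity
  | zero => simp
  | one => simp [isMultiplicative_idealCount.map_one]
  | coprime a b _ _ h iha ihb =>
    rw [isMultiplicative_idealCount.map_mul_of_coprime h]
    exact mul_nonneg iha ihb

/-- The Dirichlet convolution of the divisor function with the character modulo 3. -/
noncomputable def sigmaChi : ArithmeticFunction ℝ := (ζ * ζ : ArithmeticFunction ℝ) * chi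

theorem sigmaChi_eq : sigmaChi = idealCount * ζ := by
  rw [sigmaChi, idealCount, mul_comm, mul_assoc]

theorem isMultiplicative_sigmaChi : sigmaChi.IsMultiplicative :=
  (isMultiplicative_zeta.natCast.mul isMultiplicative_zeta.natCast).mul isMultiplicative_chi

theorem sigmaChi_nonneg (n : ℕ) : 0 ≤ sigmaChi n := by
  rw [sigmaChi_eq, coe_mul_zeta_apply]
  exact sum_nonneg fun i _ => idealCount_nonneg i

theorem sigmaChi_prime {p : ℕ} (hp : p.Prime) : sigmaChi p = 1 + idealCount p := by
  rw [sigmaChi_eq, coe_mul_zeta_apply, hp.sum_divisors, isMultiplicative_idealCount.map_one,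
    add_comm]

/-- The divisor function, with real values. -/
noncomputable def realSigma : ArithmeticFunction ℝ := ζ * ζ

theorem isMultiplicative_realSigma : realSigma.IsMultiplicative :=
  isMultiplicative_zeta.natCast.mul isMultiplicative_zeta.natCast

theorem realSigma_apply (n : ℕ) : realSigma n = n.divisors.card := by
  rw [realSigma, coe_mul_zeta_apply, sum_congr rfl (g := fun _ => (1 : ℝ)), sum_const, nsmul_one]
  intro x hx
  simp [(Nat.pos_of_mem_divisors hx).ne']

theorem exists_abs_corr_le {n : ℕ} (hn : n ≠ 0) (h0 : corr n ≠ 0) : ∃ c k e : ℕ, c ∣ 3 ∧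
    n = c * k ^ 2 * e ^ 3 ∧ |corr n| ≤ sigmaChi k * realSigma e := by
  induction n using Nat.recOnPosPrimePosCoprime with
  | prime_pow p k hp hk =>
    rw [corr_prime_pow hp] at h0 ⊢
    rw [corrTable, if_neg hk.ne'] at h0 ⊢
    have hσ : sigmaChi p = 1 + idealCount p := sigmaChi_prime hp
    have hτ : realSigma p = 2 := by
      rw [realSigma_apply, hp.divisors, card_pair hp.one_lt.ne]; norm_num
    have hi := idealCount_prime_pow hp 1
    rw [pow_one] at hi
    have h1 := isMultiplicative_sigmaChi.map_one
    have h2 := isMultiplicative_realSigma.map_one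
    split_ifs at h0 ⊢ with h3 h4 h5 h6 h7 h8
    · refine ⟨1, p, 1, by norm_num, by simp [h4], ?_⟩
      rw [hσ, hi, h2]
      norm_num [h3]
    · refine ⟨1, 1, p, by norm_num, by simp [h5], ?_⟩
      rw [hτ, h1]
      norm_num
    · exact absurd rfl h0
    · refine ⟨1, p, 1, by norm_num, by simp [h7], ?_⟩
      rw [hσ, hi, h2]
      norm_num [h6]
    · exact absurd rfl h0
    · have : p = 3 := by
        rw [eq_comm, ← Nat.prime_dvd_prime_iff_eq Nat.prime_three hp]
        omega
      refine ⟨3, 1, 1, by norm_num, by simp [this, h8], ?_⟩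
      rw [h1, h2]
      norm_num
    · exact absurd rfl h0
  | zero => exact absurd rfl hn
  | one =>
    refine ⟨1, 1, 1, by norm_num, by norm_num, ?_⟩
    simp [isMultiplicative_corr.map_one, isMultiplicative_sigmaChi.map_one,
      isMultiplicative_realSigma.map_one]
  | coprime a b ha hb h iha ihb =>
    rw [isMultiplicative_corr.map_mul_of_coprime h] at h0 ⊢
    obtain ⟨c, k, e, hc, hn, hle⟩ := iha (by omega) (left_ne_zero_of_mul h0)
    obtain ⟨c', k', e', hc', hn', hle'⟩ := ihb (by omega) (right_ne_zero_of_mul h0)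
    have hcop (x y : ℕ) (hx : x ∣ a) (hy : y ∣ b) : x.Coprime y :=
      (h.coprime_dvd_left hx).coprime_dvd_right hy
    refine ⟨c * c', k * k', e * e', (hcop c c' ?_ ?_).mul_dvd_of_dvd_of_dvd hc hc', ?_, ?_⟩
    · exact hn ▸ Dvd.intro _ (mul_assoc _ _ _).symm
    · exact hn' ▸ Dvd.intro _ (mul_assoc _ _ _).symm
    · rw [hn, hn']; ring
    · have hk : k.Coprime k' := hcop _ _ (hn ▸ ⟨c * k * e ^ 3, by ring⟩)
        (hn' ▸ ⟨c' * k' * e' ^ 3, by ring⟩)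
      have he : e.Coprime e' := hcop _ _ (hn ▸ ⟨c * k ^ 2 * e ^ 2, by ring⟩)
        (hn' ▸ ⟨c' * k' ^ 2 * e' ^ 2, by ring⟩)
      rw [isMultiplicative_sigmaChi.map_mul_of_coprime hk,
        isMultiplicative_realSigma.map_mul_of_coprime he, abs_mul, mul_mul_mul_comm]
      exact mul_le_mul hle hle' (abs_nonneg _) ((abs_nonneg _).trans hle)

/-- The arithmetic function `n ↦ f n * n ^ (-t)`. -/
noncomputable def weight (f : ArithmeticFunction ℝ) (t : ℝ) : ArithmeticFunction ℝ :=
  ⟨fun n => f n * (n : ℝ) ^ (-t), by simp⟩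

theorem weight_apply (f : ArithmeticFunction ℝ) (t : ℝ) (n : ℕ) :
    weight f t n = f n * (n : ℝ) ^ (-t) := rfl

theorem weight_mul (f g : ArithmeticFunction ℝ) (t : ℝ) :
    weight (f * g) t = weight f t * weight g t := by
  ext n
  rw [weight_apply, mul_apply, mul_apply, sum_mul]
  refine sum_congr rfl fun x hx => ?_
  rw [weight_apply, weight_apply, ← (Nat.mem_divisorsAntidiagonal.1 hx).1, Nat.cast_mul,
    Real.mul_rpow (Nat.cast_nonneg _) (Nat.cast_nonneg _)]
  ring

theorem sum_weight_zeta_le {t : ℝ} (ht : 1 < t) (N : ℕ) :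
    ∑ n ∈ Ioc 0 N, weight ζ t n ≤ 1 + 1 / (t - 1) := by
  have hε : 0 < t - 1 := by linarith
  have hz (n : ℕ) (hn : n ≠ 0) : weight ζ t n = (n : ℝ) ^ (-t) := by
    simp [weight_apply, hn]
  rcases Nat.eq_zero_or_pos N with rfl | hN
  · simp only [Ioc_self, sum_empty]
    positivity
  have key : ∑ n ∈ Ioc 0 N, weight ζ t n ≤ 1 + (1 - (N : ℝ) ^ (-(t - 1))) / (t - 1) := by
    induction N, hN using Nat.le_induction with
    | base => simp [hz]
    | succ N hN ih =>
      have hN0 : (0 : ℝ) < N := by exact_mod_cast hN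
      rw [sum_Ioc_succ_top (Nat.zero_le N), hz _ (Nat.succ_ne_zero N)]
      push_cast
      have h1 : ((N : ℝ) + 1) ^ (-t) = ((N : ℝ) + 1) ^ (-(t - 1)) * (1 / (N + 1)) := by
        rw [one_div, ← Real.rpow_neg_one, ← Real.rpow_add (by positivity)]
        ring_nf
      have h2 : ((N : ℝ) + 1) ^ (-(t - 1)) * (1 + (t - 1) * (1 / (N + 1))) ≤
          (N : ℝ) ^ (-(t - 1)) := by
        have h3 : (N : ℝ) ^ (-(t - 1)) = ((N : ℝ) + 1) ^ (-(t - 1)) *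
            (((N : ℝ) + 1) / N) ^ (t - 1) := by
          rw [Real.div_rpow (by positivity) hN0.le, mul_div_assoc', ← Real.rpow_add (by positivity),
            neg_add_cancel, Real.rpow_zero, Real.rpow_neg hN0.le, one_div]
        rw [h3]
        apply mul_le_mul_of_nonneg_left _ (by positivity)
        have h4 : 0 < ((N : ℝ) + 1) / N := by positivity
        rw [Real.rpow_def_of_pos h4]
        have h5 := Real.one_sub_inv_le_log_of_pos h4
        have h6 : 1 - (((N : ℝ) + 1) / N)⁻¹ = 1 / (N + 1) := by field_simp; ring
        rw [h6] at h5
        have := Real.add_one_le_exp (Real.log (((N : ℝ) + 1) / N) * (t - 1))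
        nlinarith
      have h7 : ((N : ℝ) + 1) ^ (-t) ≤
          ((N : ℝ) ^ (-(t - 1)) - ((N : ℝ) + 1) ^ (-(t - 1))) / (t - 1) := by
        rw [le_div_iff₀ hε, h1]
        linarith
      rw [sub_div] at *
      linarith
  have : (1 - (N : ℝ) ^ (-(t - 1))) / (t - 1) ≤ 1 / (t - 1) := by
    gcongr
    linarith [Real.rpow_nonneg (Nat.cast_nonneg N) (-(t - 1))]
  linarith

theorem weight_zeta_nonneg (t : ℝ) (n : ℕ) : 0 ≤ weight ζ t n := by
  rw [weight_apply, natCoe_apply]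
  positivity

theorem sum_weight_realSigma_le {t : ℝ} (ht : 1 < t) (N : ℕ) :
    ∑ n ∈ Ioc 0 N, weight realSigma t n ≤ (1 + 1 / (t - 1)) ^ 2 := by
  have h0 : 0 < t - 1 := by linarith
  rw [realSigma, weight_mul, sum_Ioc_mul_eq_sum_sum, sq]
  refine (sum_le_sum fun n _ => mul_le_mul_of_nonneg_left (sum_weight_zeta_le ht _)
    (weight_zeta_nonneg t n)).trans ?_
  rw [← sum_mul]
  exact mul_le_mul_of_nonneg_right (sum_weight_zeta_le ht _) (by positivity)

theorem weight_realSigma_nonneg (t : ℝ) (n : ℕ) : 0 ≤ weight realSigma t n := by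
  rw [weight_apply, realSigma_apply]
  positivity

theorem sum_weight_chi_le {t : ℝ} (ht : 0 ≤ t) (N : ℕ) : ∑ n ∈ Ioc 0 N, weight chi t n ≤ 1 := by
  refine (le_abs_self _).trans ?_
  have := abs_sum_chi_mul_le (b := fun n : ℕ => (n : ℝ) ^ (-t)) (D := 0) (fun d _ => by positivity)
    (fun d hd => Real.rpow_le_rpow_of_nonpos (by exact_mod_cast hd) (by push_cast; linarith)
      (by linarith)) N
  simpa [weight_apply] using this

theorem sum_weight_sigmaChi_le {t : ℝ} (ht : 1 < t) (N : ℕ) :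
    ∑ n ∈ Ioc 0 N, weight sigmaChi t n ≤ (1 + 1 / (t - 1)) ^ 2 := by
  refine le_trans ?_ (sum_weight_realSigma_le ht N)
  rw [sigmaChi, weight_mul, sum_Ioc_mul_eq_sum_sum]
  exact sum_le_sum fun n _ => mul_le_of_le_one_right (weight_realSigma_nonneg t n)
    (sum_weight_chi_le (by linarith) _)

theorem weight_sigmaChi_nonneg (t : ℝ) (n : ℕ) : 0 ≤ weight sigmaChi t n := by
  rw [weight_apply]
  have := sigmaChi_nonneg n
  positivity

theorem sum_abs_corr_le {δ : ℝ} (hδ : 0 < δ) (hδ1 : δ ≤ 1 / 2) (N : ℕ) :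
    ∑ n ∈ Ioc 0 N, |corr n| * (n : ℝ) ^ (-(1 / 2 + δ)) ≤ 27 / δ ^ 2 := by
  let T : Finset (ℕ × ℕ × ℕ) := Ioc 0 3 ×ˢ Ioc 0 N ×ˢ Ioc 0 N
  let φ : ℕ × ℕ × ℕ → ℕ := fun x => x.1 * x.2.1 ^ 2 * x.2.2 ^ 3
  let G : ℕ × ℕ × ℕ → ℝ := fun x => weight sigmaChi (1 + 2 * δ) x.2.1 *
    weight realSigma (3 / 2) x.2.2
  have hG (x) : 0 ≤ G x := mul_nonneg (weight_sigmaChi_nonneg _ _) (weight_realSigma_nonneg _ _)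
  have hpt (n : ℕ) (hn : n ∈ Ioc 0 N) : |corr n| * (n : ℝ) ^ (-(1 / 2 + δ)) ≤
      ∑ x ∈ T with φ x = n, G x := by
    rw [mem_Ioc] at hn
    by_cases h0 : corr n = 0
    · rw [h0, abs_zero, zero_mul]
      exact sum_nonneg fun x _ => hG x
    obtain ⟨c, k, e, hc, hnc, hle⟩ := exists_abs_corr_le hn.1.ne' h0
    have hc0 : 0 < c := Nat.pos_of_dvd_of_pos hc (by norm_num)
    have hk0 : 0 < k := Nat.pos_of_ne_zero fun h => by
      rw [hnc, h] at hn; simp at hn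
    have he0 : 0 < e := Nat.pos_of_ne_zero fun h => by
      rw [hnc, h] at hn; simp at hn
    have hkn : k ≤ n := Nat.le_of_dvd hn.1 (hnc ▸ ⟨c * k * e ^ 3, by ring⟩)
    have hen : e ≤ n := Nat.le_of_dvd hn.1 (hnc ▸ ⟨c * k ^ 2 * e ^ 2, by ring⟩)
    have hmem : (c, k, e) ∈ T.filter (fun x => φ x = n) := by
      simp only [T, φ, mem_filter, mem_product, mem_Ioc]
      exact ⟨⟨⟨hc0, Nat.le_of_dvd (by norm_num) hc⟩, ⟨hk0, hkn.trans hn.2⟩, he0, hen.trans hn.2⟩,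
        hnc.symm⟩
    refine le_trans ?_ (single_le_sum (f := G) (fun x _ => hG x) hmem)
    have hk1 : (0 : ℝ) < k := by exact_mod_cast hk0
    have he1 : (1 : ℝ) ≤ e := by exact_mod_cast he0
    have hc1 : (1 : ℝ) ≤ c := by exact_mod_cast hc0
    have hpow : (n : ℝ) ^ (-(1 / 2 + δ)) ≤
        (k : ℝ) ^ (-(1 + 2 * δ)) * (e : ℝ) ^ (-(3 / 2 : ℝ)) := by
      rw [hnc]
      push_cast
      rw [Real.mul_rpow (by positivity) (by positivity), Real.mul_rpow (by positivity)
        (by positivity), ← Real.rpow_natCast, ← Real.rpow_natCast, ← Real.rpow_mul hk1.le,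
        ← Real.rpow_mul (by linarith)]
      have h1 : (c : ℝ) ^ (-(1 / 2 + δ)) ≤ 1 := Real.rpow_le_one_of_one_le_of_nonpos hc1
        (by linarith)
      have h2 : (e : ℝ) ^ (((3 : ℕ) : ℝ) * -(1 / 2 + δ)) ≤ (e : ℝ) ^ (-(3 / 2 : ℝ)) := by
        apply Real.rpow_le_rpow_of_exponent_le he1
        push_cast; linarith
      have h3 : (k : ℝ) ^ (((2 : ℕ) : ℝ) * -(1 / 2 + δ)) = (k : ℝ) ^ (-(1 + 2 * δ)) := by
        congr 1; push_cast; ring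
      rw [h3]
      apply mul_le_mul _ h2 (by positivity) (by positivity)
      exact mul_le_of_le_one_left (by positivity) h1
    calc |corr n| * (n : ℝ) ^ (-(1 / 2 + δ)) ≤ (sigmaChi k * realSigma e) *
          ((k : ℝ) ^ (-(1 + 2 * δ)) * (e : ℝ) ^ (-(3 / 2 : ℝ))) :=
        mul_le_mul hle hpow (by positivity) ((abs_nonneg _).trans hle)
      _ = G (c, k, e) := by simp only [G, weight_apply]; ring
  have hfib := sum_fiberwise_le_sum_of_sum_fiber_nonneg (s := T) (t := Ioc 0 N) (g := φ) (f := G)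
    (fun n _ => sum_nonneg fun x _ => hG x)
  refine (sum_le_sum hpt).trans (hfib.trans ?_)
  have hT : ∑ x ∈ T, G x = 3 * ((∑ k ∈ Ioc 0 N, weight sigmaChi (1 + 2 * δ) k) *
      ∑ e ∈ Ioc 0 N, weight realSigma (3 / 2) e) := by
    simp only [T, G, sum_product, sum_mul_sum]
    simp
  rw [hT]
  have h1 := sum_weight_sigmaChi_le (t := 1 + 2 * δ) (by linarith) N
  have h2 := sum_weight_realSigma_le (t := 3 / 2) (by norm_num) N
  have h3 : (1 + 1 / (1 + 2 * δ - 1)) ^ 2 ≤ 1 / δ ^ 2 := by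
    rw [← one_div_pow]
    apply pow_le_pow_left₀
    · have : 0 < 1 + 2 * δ - 1 := by linarith
      positivity
    · rw [show 1 + 2 * δ - 1 = 2 * δ by ring, ← sub_nonneg]
      have : 1 / δ - (1 + 1 / (2 * δ)) = (1 / 2 - δ) / δ := by field_simp; ring
      rw [this]
      apply div_nonneg _ hδ.le
      linarith
  have h4 := mul_le_mul (h1.trans h3) h2 (sum_nonneg fun x _ => weight_realSigma_nonneg _ _)
    (by positivity)
  calc _ ≤ 3 * (1 / δ ^ 2 * (1 + 1 / (3 / 2 - 1)) ^ 2) := by linarith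
    _ = 27 / δ ^ 2 := by norm_num; ring

end EisensteinInt

namespace EisensteinInt

open ArithmeticFunction Finset Filter

theorem exists_sum_corr_div : ∃ S : ℝ,
    Tendsto (fun M : ℕ => ∑ d ∈ Ioc 0 M, corr d / d) atTop (nhds S) := by
  have hIoc (f : ℕ → ℝ) (h0 : f 0 = 0) (M : ℕ) : ∑ d ∈ Ioc 0 M, f d = ∑ d ∈ range (M + 1), f d := by
    induction M with
    | zero => simp [h0]
    | succ M ih => rw [sum_Ioc_succ_top (Nat.zero_le M), ih, sum_range_succ f (M + 1)]
  have hs : Summable fun d : ℕ => corr d / (d : ℝ) := by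
    apply Summable.of_norm
    refine summable_of_sum_range_le (c := 27 / (1 / 2 : ℝ) ^ 2) (fun d => _root_.norm_nonneg _) fun M => ?_
    calc _ ≤ ∑ d ∈ range (M + 1), ‖corr d / (d : ℝ)‖ :=
        sum_le_sum_of_subset_of_nonneg (range_mono (Nat.le_succ M)) fun _ _ _ => _root_.norm_nonneg _
      _ = ∑ d ∈ Ioc 0 M, ‖corr d / (d : ℝ)‖ := (hIoc _ (by simp) M).symm
      _ = ∑ d ∈ Ioc 0 M, |corr d| * (d : ℝ) ^ (-(1 / 2 + 1 / 2 : ℝ)) := by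
        refine sum_congr rfl fun d _ => ?_
        rw [norm_div, Real.norm_eq_abs, RCLike.norm_natCast, add_halves, Real.rpow_neg_one,
          div_eq_mul_inv]
      _ ≤ _ := sum_abs_corr_le (by norm_num) le_rfl M
  refine ⟨∑' d : ℕ, corr d / (d : ℝ), ?_⟩
  have := (tendsto_add_atTop_iff_nat 1).2 hs.hasSum.tendsto_sum_nat
  exact this.congr fun M => (hIoc _ (by simp) M).symm

theorem sum_realCoeff_eq {y : ℝ} {M : ℕ} (hM : ⌊y⌋₊ ≤ M) : ∑ n ∈ Ioc 0 ⌊y⌋₊, realCoeff n =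
    ∑ d ∈ Ioc 0 M, corr d * ∑ m ∈ Ioc 0 ⌊y / d⌋₊, idealCount m := by
  rw [realCoeff_eq, sum_Ioc_mul_eq_sum_sum]
  simp only [Nat.floor_div_natCast]
  refine sum_subset (Ioc_subset_Ioc_right hM) fun d hd hd' => ?_
  rw [mem_Ioc] at hd hd'
  rw [Nat.div_eq_of_lt (by omega), Ioc_self, sum_empty, mul_zero]

theorem exists_abs_sum_realCoeff_sub_le : ∃ c C : ℝ, 0 ≤ C ∧ ∀ y δ : ℝ, 0 < y → 0 < δ → δ ≤ 1 / 2 →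
    |∑ n ∈ Ioc 0 ⌊y⌋₊, realCoeff n - c * y| ≤ C * (y ^ (1 / 2 + δ) / δ ^ 2) := by
  obtain ⟨L, C, hC, hR⟩ := exists_sum_idealCount
  obtain ⟨S, hS⟩ := exists_sum_corr_div
  refine ⟨L * S, 27 * C, by positivity, fun y δ hy hδ hδ1 => ?_⟩
  have hlim : Tendsto (fun M : ℕ => |∑ n ∈ Ioc 0 ⌊y⌋₊, realCoeff n -
      L * y * ∑ d ∈ Ioc 0 M, corr d / d|) atTop
      (nhds |∑ n ∈ Ioc 0 ⌊y⌋₊, realCoeff n - L * y * S|) :=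
    ((hS.const_mul (L * y)).const_sub _).abs
  rw [mul_right_comm L S y]
  refine le_of_tendsto hlim (eventually_atTop.2 ⟨⌊y⌋₊, fun M hM => ?_⟩)
  rw [sum_realCoeff_eq hM, mul_sum, ← sum_sub_distrib]
  refine (abs_sum_le_sum_abs _ _).trans ?_
  have hpt (d : ℕ) (hd : d ∈ Ioc 0 M) :
      |corr d * ∑ m ∈ Ioc 0 ⌊y / d⌋₊, idealCount m - L * y * (corr d / d)| ≤
      C * y ^ (1 / 2 + δ) * (|corr d| * (d : ℝ) ^ (-(1 / 2 + δ))) := by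
    have hd0 : (0 : ℝ) < d := by exact_mod_cast (mem_Ioc.1 hd).1
    have h1 := hR (y / d) (1 / 2 + δ) (by positivity) (by linarith) (by linarith)
    have h2 : corr d * ∑ m ∈ Ioc 0 ⌊y / d⌋₊, idealCount m - L * y * (corr d / d) =
        corr d * (∑ m ∈ Ioc 0 ⌊y / d⌋₊, idealCount m - L * (y / d)) := by ring
    rw [h2, abs_mul]
    refine (mul_le_mul_of_nonneg_left h1 (abs_nonneg _)).trans_eq ?_
    rw [Real.div_rpow hy.le hd0.le, Real.rpow_neg hd0.le]
    ring
  refine (sum_le_sum hpt).trans ?_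
  rw [← mul_sum]
  refine (mul_le_mul_of_nonneg_left (sum_abs_corr_le hδ hδ1 M) (by positivity)).trans_eq ?_
  ring

theorem pos_of_abs_sum_realCoeff_sub_le {c C : ℝ}
    (h : ∀ y : ℝ, 0 < y → |∑ n ∈ Ioc 0 ⌊y⌋₊, realCoeff n - c * y| ≤ C * y ^ (3 / 4 : ℝ)) : 0 < c := by
  by_contra hc
  have hnn (n : ℕ) : 0 ≤ realCoeff n := by
    rw [realCoeff_apply]; positivity
  have hO : (fun n : ℕ => ∑ k ∈ Icc 1 n, realCoeff k) =O[atTop]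
      fun n : ℕ => (n : ℝ) ^ (3 / 4 : ℝ) := by
    refine Asymptotics.IsBigO.of_bound C (eventually_atTop.2 ⟨1, fun n hn => ?_⟩)
    have hn0 : (0 : ℝ) < n := by exact_mod_cast hn
    have h1 := (abs_le.1 (h n hn0)).2
    rw [Nat.floor_natCast] at h1
    rw [Real.norm_of_nonneg (sum_nonneg fun k _ => hnn k), Real.norm_of_nonneg (by positivity)]
    have h2 : Icc 1 n = Ioc 0 n := rfl
    rw [h2]
    nlinarith
  have hs := LSeriesSummable_of_sum_norm_bigO_and_nonneg (s := ((9 / 10 : ℝ) : ℂ)) hO hnn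
    (by norm_num) (by rw [Complex.ofReal_re]; norm_num)
  have hs' : Summable fun n : ℕ => 10 * ‖LSeries.term (fun n => (realCoeff n : ℂ))
      ((9 / 10 : ℝ) : ℂ) n‖ := hs.norm.mul_left 10
  refine vonMangoldt.not_summable_residueClass_prime_div (q := 3) (a := 1) isUnit_one
    (hs'.of_nonneg_of_le (fun n => ?_) fun n => ?_)
  · have := vonMangoldt.residueClass_nonneg (1 : ZMod 3) n
    positivity
  · by_cases hn : n.Prime ∧ n % 3 = 1
    · obtain ⟨hp, h3⟩ := hn
      have hp0 : (0 : ℝ) < n := by exact_mod_cast hp.pos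
      have ha : realCoeff n = 2 := by
        have := realCoeff_prime_pow hp 1
        rw [pow_one] at this
        simp [this, h3]
      rw [if_pos hp, LSeries.norm_term_eq, if_neg hp.ne_zero, Complex.ofReal_re, ha,
        Complex.norm_real]
      have hle := (vonMangoldt.residueClass_le (1 : ZMod 3) n).trans_eq
        (vonMangoldt_apply_prime hp)
      have hlog := Real.log_le_rpow_div hp0.le (show (0 : ℝ) < 1 / 10 by norm_num)
      have hpow : (n : ℝ) = (n : ℝ) ^ (1 / 10 : ℝ) * (n : ℝ) ^ (9 / 10 : ℝ) := by
        rw [← Real.rpow_add hp0]; norm_num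
      have hq : 0 < (n : ℝ) ^ (1 / 10 : ℝ) := by positivity
      have hr : 0 < (n : ℝ) ^ (9 / 10 : ℝ) := by positivity
      rw [div_le_iff₀ hp0]
      calc _ ≤ 10 * (n : ℝ) ^ (1 / 10 : ℝ) := by linarith
        _ ≤ 20 * (n : ℝ) ^ (1 / 10 : ℝ) := by linarith
        _ = 10 * (‖(2 : ℝ)‖ / (n : ℝ) ^ (9 / 10 : ℝ)) *
            ((n : ℝ) ^ (1 / 10 : ℝ) * (n : ℝ) ^ (9 / 10 : ℝ)) := by
          rw [Real.norm_ofNat]; field_simp; norm_num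
        _ = _ := by rw [← hpow]
    · have : (if n.Prime then vonMangoldt.residueClass (1 : ZMod 3) n else 0) = 0 := by
        split_ifs with hp
        · apply Set.indicator_of_notMem
          intro hmem
          apply hn
          refine ⟨hp, ?_⟩
          have h1 : ((n : ℕ) : ZMod 3) = ((1 : ℕ) : ZMod 3) := by
            rw [Nat.cast_one]; exact hmem
          exact (ZMod.natCast_eq_natCast_iff' n 1 3).1 h1
        · rfl
      rw [this, zero_div]
      positivity

theorem exists_sum_coeff : ∃ c C : ℝ, 0 < c ∧ 0 ≤ C ∧ ∀ y : ℝ, Real.exp 2 ≤ y →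
    |((∑ n ∈ Icc 1 ⌊y⌋₊, coeff n : ℕ) : ℝ) - c * y| ≤ C * (√y * Real.log y ^ 2) := by
  obtain ⟨c, C, hC, h⟩ := exists_abs_sum_realCoeff_sub_le
  refine ⟨c, C * Real.exp 1, ?_, by positivity, fun y hy => ?_⟩
  · refine pos_of_abs_sum_realCoeff_sub_le (C := 16 * C) fun y hy => ?_
    refine (h y (1 / 4) hy (by norm_num) (by norm_num)).trans_eq ?_
    norm_num
    ring
  · have hy0 : 0 < y := (Real.exp_pos 2).trans_le hy
    have hlog : 2 ≤ Real.log y := (Real.le_log_iff_exp_le hy0).2 hy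
    have h1 := h y (1 / Real.log y) hy0 (by positivity) (by gcongr)
    have h2 : y ^ (1 / 2 + 1 / Real.log y) / (1 / Real.log y) ^ 2 =
        Real.exp 1 * (√y * Real.log y ^ 2) := by
      rw [Real.rpow_add hy0, Real.sqrt_eq_rpow, one_div (Real.log y), Real.rpow_inv_log hy0 ?_]
      · field_simp
      · rintro rfl
        norm_num at hlog
    rw [h2, ← mul_assoc] at h1
    push_cast
    exact h1

end EisensteinInt

theorem count_C3_fields :
    ∃ c : ℝ, 0 < c ∧
      (fun X : ℝ => (galoisCount (Multiplicative (ZMod 3)) X : ℝ) - c * X ^ ((1:ℝ)/2))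
        =O[Filter.atTop] fun X : ℝ => X ^ ((1:ℝ)/4) * Real.log X ^ 2 := by
  obtain ⟨c, C, hc, hC, h⟩ := EisensteinInt.exists_sum_coeff
  refine ⟨c / 2 + c / 9, by positivity, ?_⟩
  refine Asymptotics.IsBigO.of_bound (1 / 2 + 3 / 2 * C)
    (Filter.eventually_atTop.2 ⟨(9 * Real.exp 2) ^ 2, fun X hX => ?_⟩)
  have he : 1 ≤ Real.exp 2 := Real.one_le_exp (by norm_num)
  have hs : 9 * Real.exp 2 ≤ √X := Real.le_sqrt_of_sq_le hX
  have hX1 : 1 ≤ X := by nlinarith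
  have hX0 : 0 < X := by linarith
  have hlog : 2 ≤ Real.log X := by
    rw [Real.le_log_iff_exp_le hX0]; nlinarith
  have hlogs : Real.log √X ≤ Real.log X := by
    rw [Real.log_sqrt hX0.le]; linarith
  have h4 : √√X = X ^ ((1 : ℝ) / 4) := by
    rw [Real.sqrt_eq_rpow, Real.sqrt_eq_rpow, ← Real.rpow_mul hX0.le]; norm_num
  have hbound (y : ℝ) (hy : Real.exp 2 ≤ y) (hyX : y ≤ √X) :
      √y * Real.log y ^ 2 ≤ X ^ ((1 : ℝ) / 4) * Real.log X ^ 2 := by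
    have hy0 : 0 < y := by linarith
    have h1 : 0 ≤ Real.log y := Real.log_nonneg (by linarith)
    have h2 : Real.log y ≤ Real.log X := (Real.log_le_log hy0 hyX).trans hlogs
    rw [← h4]
    gcongr
  have hA := (h √X (by linarith)).trans (mul_le_mul_of_nonneg_left
    (hbound √X (by linarith) le_rfl) hC)
  have hB := (h (√X / 9) (by linarith)).trans (mul_le_mul_of_nonneg_left
    (hbound (√X / 9) (by linarith) (by linarith)) hC)
  have hcount : (2 : ℝ) * galoisCount (Multiplicative (ZMod 3)) X + 1 =
      ((∑ n ∈ Finset.Icc 1 ⌊√X⌋₊, EisensteinInt.coeff n : ℕ) : ℝ) +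
        2 * ((∑ n ∈ Finset.Icc 1 ⌊√X / 9⌋₊, EisensteinInt.coeff n : ℕ) : ℝ) := by
    exact_mod_cast EisensteinInt.two_mul_galoisCount hX1
  have hE : 1 ≤ X ^ ((1 : ℝ) / 4) * Real.log X ^ 2 :=
    one_le_mul_of_one_le_of_one_le (Real.one_le_rpow hX1 (by norm_num)) (by nlinarith)
  rw [← Real.sqrt_eq_rpow, Real.norm_eq_abs, Real.norm_of_nonneg (by linarith)]
  generalize X ^ ((1 : ℝ) / 4) * Real.log X ^ 2 = E at *
  rw [abs_le] at *
  constructor <;> linarith
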